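/- arXiv:1710.07852 — 8 statements merged into one kernel-verified Lean document; each statement's English description precedes it below -/
import Mathlib

section
/- Let 1 ≤ p < q < ∞. There exist a map f : ℓ_p → ℓ_q and constants A, B > 0 such that A·‖x − y‖^{p/q} ≤ ‖f(x) − f(y)‖ ≤ B·‖x − y‖^{p/q} for all x, y ∈ ℓ_p (so f is simultaneously a coarse embedding and a uniform embedding), and f is weakly sequentially continuous. -/
open Filter

/-- A map between normed spaces is *coarse* if points at distance at most `t`
are mapped to points at uniformly bounded distance. -/
def Coarse {X Y : Type*} [NormedAddCommGroup X] [NormedAddCommGroup Y]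
    (f : X → Y) : Prop :=
  ∀ t : ℝ, 0 ≤ t → ∃ C : ℝ, ∀ x y : X, ‖x - y‖ ≤ t → ‖f x - f y‖ ≤ C

/-- Property (*): there are `0 < α < β` and `b > 0` such that points at distance
in `[α, β]` are mapped to points at distance at least `b`. -/
def PropertyStar {X Y : Type*} [NormedAddCommGroup X] [NormedAddCommGroup Y]
    (f : X → Y) : Prop :=
  ∃ α β b : ℝ, 0 < α ∧ α < β ∧ 0 < b ∧
    ∀ x y : X, α ≤ ‖x - y‖ → ‖x - y‖ ≤ β → b ≤ ‖f x - f y‖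

/-- A map is weakly sequentially continuous if it sends weakly convergent
sequences to weakly convergent sequences. -/
def WeakSeqCont {X Y : Type*} [NormedAddCommGroup X] [NormedSpace ℝ X]
    [NormedAddCommGroup Y] [NormedSpace ℝ Y] (f : X → Y) : Prop :=
  ∀ (x : ℕ → X) (x₀ : X),
    (∀ φ : X →L[ℝ] ℝ, Tendsto (fun n => φ (x n)) atTop (nhds (φ x₀))) →
    ∀ ψ : Y →L[ℝ] ℝ, Tendsto (fun n => ψ (f (x n))) atTop (nhds (ψ (f x₀)))

/-- The modulus of asymptotic uniform convexity `δ̄_Y(t)`. -/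
noncomputable def AUCmod (Y : Type*) [NormedAddCommGroup Y] [NormedSpace ℝ Y] (t : ℝ) : ℝ :=
  sInf { r : ℝ | ∃ x : Y, ‖x‖ = 1 ∧
    r = sSup { s : ℝ | ∃ E : Subspace ℝ Y, IsClosed (E : Set Y) ∧
      FiniteDimensional ℝ (Y ⧸ E) ∧
      s = sInf { u : ℝ | ∃ y : Y, y ∈ E ∧ ‖y‖ = 1 ∧ u = ‖x + t • y‖ - 1 } } }

/-- `(e_n)` in `S` is a spreading model of the bounded sequence `(x_n)` in `X`. -/
def IsSpreadingModel {X S : Type*} [NormedAddCommGroup X] [NormedSpace ℝ X]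
    [NormedAddCommGroup S] [NormedSpace ℝ S] (x : ℕ → X) (e : ℕ → S) : Prop :=
  ∀ ε : ℝ, 0 < ε → ∀ k : ℕ, ∃ ℓ : ℕ, ∀ n : Fin k → ℕ,
    StrictMono n → (∀ i, ℓ ≤ n i) → ∀ a : Fin k → ℝ, (∀ i, |a i| ≤ 1) →
      |‖∑ i, a i • x (n i)‖ - ‖∑ i, a i • e (i : ℕ)‖| ≤ ε

theorem lp.memℓp_apply_single {α : Type*} [DecidableEq α] {q r : ℝ} (hqr : q.HolderConjugate r)
    [Fact (1 ≤ ENNReal.ofReal q)] (ψ : lp (fun _ : α => ℝ) (ENNReal.ofReal q) →L[ℝ] ℝ) :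
    Memℓp (fun i => ψ (lp.single (ENNReal.ofReal q) i 1)) (ENNReal.ofReal r) := by
  have hq : (ENNReal.ofReal q).toReal = q := ENNReal.toReal_ofReal hqr.nonneg
  have hr : (ENNReal.ofReal r).toReal = r := ENNReal.toReal_ofReal hqr.symm.nonneg
  have hq0 := hqr.pos
  have hr0 := hqr.symm.pos
  have hr1 := hqr.symm.lt
  set b : α → ℝ := fun i => ψ (lp.single (ENNReal.ofReal q) i 1) with hb
  refine memℓp_gen' (C := ‖ψ‖ ^ r) fun s => ?_
  rw [hr]
  set S := ∑ i ∈ s, ‖b i‖ ^ r with hS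
  have hS0 : 0 ≤ S := Finset.sum_nonneg fun i _ => by positivity
  set c : α → ℝ := fun i => b i * ‖b i‖ ^ (r - 2)
  have hc : ∀ i, ‖c i‖ ^ q = ‖b i‖ ^ r := by
    intro i
    rcases eq_or_ne (b i) 0 with h | h
    · simp [c, h, Real.zero_rpow hq0.ne', Real.zero_rpow hr0.ne']
    · have h' : 0 < ‖b i‖ := norm_pos_iff.2 h
      have : ‖c i‖ = ‖b i‖ ^ (r - 1) := by
        simp only [c, norm_mul, Real.norm_of_nonneg (Real.rpow_nonneg (norm_nonneg (b i)) _)]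
        rw [← Real.rpow_one_add' h'.le (by linarith)]
        ring_nf
      rw [this, ← Real.rpow_mul h'.le, hqr.symm.sub_one_mul_conj]
  have hcb : ∀ i, c i * b i = ‖b i‖ ^ r := by
    intro i
    rcases eq_or_ne (b i) 0 with h | h
    · simp [c, h, Real.zero_rpow hr0.ne']
    · have h' : 0 < ‖b i‖ := norm_pos_iff.2 h
      have : c i * b i = ‖b i‖ ^ (2 : ℝ) * ‖b i‖ ^ (r - 2) := by
        simp only [c, Real.rpow_two, Real.norm_eq_abs, sq_abs]
        ring
      rw [this, ← Real.rpow_add h']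
      ring_nf
  have hψ : ψ (∑ i ∈ s, lp.single (ENNReal.ofReal q) i (c i)) = S := by
    rw [map_sum]
    refine Finset.sum_congr rfl fun i _ => ?_
    have : lp.single (E := fun _ : α => ℝ) (ENNReal.ofReal q) i (c i)
        = c i • lp.single (ENNReal.ofReal q) i (1 : ℝ) := by
      rw [← lp.single_smul]; simp
    rw [this, map_smul, smul_eq_mul, ← hcb]
  have hnorm : ‖∑ i ∈ s, lp.single (E := fun _ : α => ℝ) (ENNReal.ofReal q) i (c i)‖ ^ q = S := by
    have := lp.norm_sum_single (E := fun _ : α => ℝ) (p := ENNReal.ofReal q) (by rwa [hq]) c s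
    rw [hq] at this
    rw [this]
    exact Finset.sum_congr rfl fun i _ => hc i
  have hle : S ≤ ‖ψ‖ * S ^ (1 / q) := by
    calc S ≤ ‖ψ (∑ i ∈ s, lp.single (ENNReal.ofReal q) i (c i))‖ := by
            rw [hψ]; exact le_abs_self S
      _ ≤ ‖ψ‖ * ‖∑ i ∈ s, lp.single (E := fun _ : α => ℝ) (ENNReal.ofReal q) i (c i)‖ :=
            ψ.le_opNorm _
      _ = ‖ψ‖ * S ^ (1 / q) := by
            rw [← hnorm, ← Real.rpow_mul (norm_nonneg _), mul_one_div_cancel hq0.ne',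
              Real.rpow_one]
  rcases hS0.eq_or_lt with h | h
  · rw [← h]; positivity
  · have h1 : S ^ (1 / r) ≤ ‖ψ‖ := by
      have h2 : S = S ^ (1 / r) * S ^ (1 / q) := by
        rw [← Real.rpow_add h, one_div, one_div, add_comm, hqr.inv_add_inv_eq_one, Real.rpow_one]
      have h3 : 0 < S ^ (1 / q) := by positivity
      exact le_of_mul_le_mul_right (h2 ▸ hle) h3
    calc S = (S ^ (1 / r)) ^ r := by
          rw [← Real.rpow_mul h.le, one_div_mul_cancel hr0.ne', Real.rpow_one]
      _ ≤ ‖ψ‖ ^ r := by gcongr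

/-- In `ℓ^q` with `1 < q < ∞`, bounded coordinatewise convergent families converge weakly. -/
theorem lp.tendsto_dual_of_tendsto_apply {α ι : Type*} {q : ℝ} (hq1 : 1 < q)
    [Fact (1 ≤ ENNReal.ofReal q)] {l : Filter ι} {y : ι → lp (fun _ : α => ℝ) (ENNReal.ofReal q)}
    {y₀ : lp (fun _ : α => ℝ) (ENNReal.ofReal q)} {C : ℝ} (hC : ∀ n, ‖y n‖ ≤ C)
    (h : ∀ i, Tendsto (fun n => y n i) l (nhds (y₀ i)))
    (ψ : lp (fun _ : α => ℝ) (ENNReal.ofReal q) →L[ℝ] ℝ) :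
    Tendsto (fun n => ψ (y n)) l (nhds (ψ y₀)) := by
  classical
  obtain ⟨r, hqr⟩ : ∃ r, q.HolderConjugate r := ⟨_, Real.HolderConjugate.conjExponent hq1⟩
  have hq : (ENNReal.ofReal q).toReal = q := ENNReal.toReal_ofReal hqr.nonneg
  have hr : (ENNReal.ofReal r).toReal = r := ENNReal.toReal_ofReal hqr.symm.nonneg
  have : Fact (1 ≤ ENNReal.ofReal r) := ⟨by simpa using hqr.symm.lt.le⟩
  let b : lp (fun _ : α => ℝ) (ENNReal.ofReal r) := ⟨_, lp.memℓp_apply_single hqr ψ⟩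
  have hψ (z : lp (fun _ : α => ℝ) (ENNReal.ofReal q)) : HasSum (fun i => b i * z i) (ψ z) := by
    have := (lp.hasSum_single ENNReal.ofReal_ne_top z).map ψ ψ.continuous
    convert this using 2 with i
    have : lp.single (E := fun _ : α => ℝ) (ENNReal.ofReal q) i (z i)
        = z i • lp.single (ENNReal.ofReal q) i (1 : ℝ) := by
      rw [← lp.single_smul]; simp
    simp only [Function.comp_apply]
    rw [this, map_smul, smul_eq_mul, mul_comm]
  have htail (s : Finset α) (z : lp (fun _ : α => ℝ) (ENNReal.ofReal q)) :
      |ψ z| ≤ |∑ i ∈ s, b i * z i| + ‖b - ∑ i ∈ s, lp.single (ENNReal.ofReal r) i (b i)‖ * ‖z‖ := by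
    set b' := b - ∑ i ∈ s, lp.single (ENNReal.ofReal r) i (b i) with hb'
    have hfin : HasSum (fun i => (if i ∈ s then b i else 0) * z i) (∑ i ∈ s, b i * z i) := by
      have : ∑ i ∈ s, b i * z i = ∑ i ∈ s, (if i ∈ s then b i else 0) * z i :=
        Finset.sum_congr rfl fun i hi => by simp [hi]
      rw [this]
      exact hasSum_sum_of_ne_finset_zero fun i hi => by simp [hi]
    have hsub : HasSum (fun i => b' i * z i) (ψ z - ∑ i ∈ s, b i * z i) := by
      have hfun : (fun i => b' i * z i) =
          fun i => b i * z i - (if i ∈ s then b i else 0) * z i := by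
        funext i
        have : b' i = b i - if i ∈ s then b i else 0 := by
          simp only [hb', lp.coeFn_sub, lp.coeFn_sum, lp.coeFn_single, Pi.sub_apply,
            Finset.sum_apply, Finset.sum_pi_single]
        rw [this, sub_mul]
      rw [hfun]
      exact (hψ z).sub hfin
    have hH := lp.tsum_mul_le_mul_norm (by rw [hq, hr]; exact hqr.symm) b' z
    have : |ψ z - ∑ i ∈ s, b i * z i| ≤ ‖b'‖ * ‖z‖ := by
      rw [← hsub.tsum_eq, ← Real.norm_eq_abs]
      refine (norm_tsum_le_tsum_norm (by simpa only [norm_mul] using hH.1)).trans ?_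
      simpa only [norm_mul] using hH.2
    have := abs_add_le (∑ i ∈ s, b i * z i) (ψ z - ∑ i ∈ s, b i * z i)
    rw [add_sub_cancel] at this
    linarith
  rw [Metric.tendsto_nhds]
  intro ε hε
  set K := |C| + ‖y₀‖ + 1 with hK
  have hK0 : 0 < K := by positivity
  obtain ⟨s, hs⟩ : ∃ s : Finset α,
      ‖b - ∑ i ∈ s, lp.single (ENNReal.ofReal r) i (b i)‖ < ε / 2 / K := by
    have := lp.hasSum_single ENNReal.ofReal_ne_top b
    obtain ⟨s, hs⟩ := ((Metric.tendsto_nhds.1 this) (ε / 2 / K) (by positivity)).exists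
    exact ⟨s, by rwa [dist_comm, dist_eq_norm] at hs⟩
  have hlim : Tendsto (fun n => ∑ i ∈ s, b i * (y n i - y₀ i)) l (nhds 0) := by
    have : Tendsto (fun n => ∑ i ∈ s, b i * (y n i - y₀ i)) l
        (nhds (∑ i ∈ s, b i * (y₀ i - y₀ i))) :=
      tendsto_finsetSum _ fun i _ => ((h i).sub_const _).const_mul _
    simpa using this
  filter_upwards [(Metric.tendsto_nhds.1 hlim) (ε / 2) (by positivity)] with n hn
  rw [Real.dist_eq, ← map_sub]
  have h1 := htail s (y n - y₀)
  have h2 : ‖y n - y₀‖ ≤ K := by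
    have := norm_sub_le (y n) y₀
    have := hC n
    have := le_abs_self C
    linarith
  have h3 : ‖b - ∑ i ∈ s, lp.single (ENNReal.ofReal r) i (b i)‖ * ‖y n - y₀‖ ≤ ε / 2 := by
    calc _ ≤ ε / 2 / K * K := by gcongr
      _ = ε / 2 := by field_simp
  rw [Real.dist_eq, sub_zero] at hn
  simp only [lp.coeFn_sub, Pi.sub_apply] at h1
  linarith

theorem exists_norm_le_of_tendsto_dual {X : Type*} [NormedAddCommGroup X] [NormedSpace ℝ X]
    {x : ℕ → X} {x₀ : X}
    (h : ∀ φ : X →L[ℝ] ℝ, Tendsto (fun n => φ (x n)) atTop (nhds (φ x₀))) :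
    ∃ C, ∀ n, ‖x n‖ ≤ C := by
  obtain ⟨C, hC⟩ := banach_steinhaus
    (g := fun n => NormedSpace.inclusionInDoubleDual ℝ X (x n)) fun φ => by
      obtain ⟨C, hC⟩ := (h φ).norm.bddAbove_range
      exact ⟨C, fun n => by simpa using hC ⟨n, rfl⟩⟩
  exact ⟨C, fun n => by
    rw [← (NormedSpace.inclusionInDoubleDualLi (E := X) ℝ).norm_map (x n)]
    exact hC n⟩

/-- The two coordinates of the unit circle, based at the point of angle zero. -/
noncomputable def circleCoord (b : Bool) (u : ℝ) : ℝ :=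
  if b then Real.sin u else Real.cos u - 1

theorem circleCoord_zero (b : Bool) : circleCoord b 0 = 0 := by
  cases b <;> simp [circleCoord]

theorem continuous_circleCoord (b : Bool) : Continuous (circleCoord b) := by
  cases b
  · exact Real.continuous_cos.sub continuous_const
  · exact Real.continuous_sin

theorem abs_circleCoord_sub_le (b : Bool) (u v : ℝ) :
    |circleCoord b u - circleCoord b v| ≤ |u - v| := by
  cases b
  · simpa [circleCoord] using Real.abs_cos_sub_cos_le u v
  · simpa [circleCoord] using Real.abs_sin_sub_sin_le u v

theorem abs_circleCoord_sub_le_two (b : Bool) (u v : ℝ) :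
    |circleCoord b u - circleCoord b v| ≤ 2 := by
  rw [abs_le]
  cases b
  · have := Real.cos_le_one u
    have := Real.cos_le_one v
    have := Real.neg_one_le_cos u
    have := Real.neg_one_le_cos v
    constructor <;> simp [circleCoord] <;> linarith
  · have := Real.sin_le_one u
    have := Real.sin_le_one v
    have := Real.neg_one_le_sin u
    have := Real.neg_one_le_sin v
    constructor <;> simp [circleCoord] <;> linarith

theorem exists_half_le_abs_circleCoord_sub {u v : ℝ} (h₁ : 1 ≤ |u - v|) (h₂ : |u - v| ≤ 2) :
    ∃ b, 1 / 2 ≤ |circleCoord b u - circleCoord b v| := by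
  by_contra! h
  have hs := h true
  have hc := h false
  simp only [circleCoord, if_true, Bool.false_eq_true, if_false, sub_sub_sub_cancel_right]
    at hs hc
  have hcos : Real.cos (u - v) ≤ 5 / 9 := by
    rw [← Real.cos_abs]
    exact (Real.cos_le_cos_of_nonneg_of_le_pi zero_le_one
      (h₂.trans (by linarith [Real.pi_gt_three])) h₁).trans Real.cos_one_le
  rw [Real.cos_sub] at hcos
  have hs2 : (Real.sin u - Real.sin v) ^ 2 < (1 / 2) ^ 2 := sq_lt_sq' (abs_lt.1 hs).1 (abs_lt.1 hs).2
  have hc2 : (Real.cos u - Real.cos v) ^ 2 < (1 / 2) ^ 2 := sq_lt_sq' (abs_lt.1 hc).1 (abs_lt.1 hc).2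
  nlinarith [Real.sin_sq_add_cos_sq u, Real.sin_sq_add_cos_sq v]

/-- Coordinates of an embedding of the real line, with metric `|s - t| ^ (p / q)`, into `ℓ^q`. -/
noncomputable def snowflakeCoord (p q : ℝ) (k : ℤ × Bool) (t : ℝ) : ℝ :=
  ((2 : ℝ) ^ k.1) ^ (-(p / q)) * circleCoord k.2 ((2 : ℝ) ^ k.1 * t)

theorem snowflakeCoord_zero (p q : ℝ) (k : ℤ × Bool) : snowflakeCoord p q k 0 = 0 := by
  simp [snowflakeCoord, circleCoord_zero]

theorem continuous_snowflakeCoord (p q : ℝ) (k : ℤ × Bool) : Continuous (snowflakeCoord p q k) :=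
  continuous_const.mul ((continuous_circleCoord _).comp (continuous_const.mul continuous_id))

theorem abs_snowflakeCoord_sub_rpow {p q : ℝ} (hq : 0 < q) (k : ℤ × Bool) (s t : ℝ) :
    |snowflakeCoord p q k s - snowflakeCoord p q k t| ^ q =
      ((2 : ℝ) ^ k.1) ^ (-p) *
        |circleCoord k.2 ((2 : ℝ) ^ k.1 * s) - circleCoord k.2 ((2 : ℝ) ^ k.1 * t)| ^ q := by
  have h2 : (0 : ℝ) < (2 : ℝ) ^ k.1 := by positivity
  rw [snowflakeCoord, snowflakeCoord, ← mul_sub, abs_mul,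
    Real.mul_rpow (abs_nonneg _) (abs_nonneg _), abs_of_pos (Real.rpow_pos_of_pos h2 _),
    ← Real.rpow_mul h2.le]
  congr 2
  field_simp

/-- Bounds the contribution of the scale `2 ^ j`, relative to the distance of the two points. -/
noncomputable def scaleBound (p q : ℝ) (j : ℤ) : ℝ :=
  ((2 : ℝ) ^ j) ^ (-p) * (2 * min ((2 : ℝ) ^ j) 1) ^ q

theorem scaleBound_pos (p q : ℝ) (j : ℤ) : 0 < scaleBound p q j := by
  have : (0 : ℝ) < min ((2 : ℝ) ^ j) 1 := lt_min (by positivity) one_pos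
  unfold scaleBound
  positivity

theorem summable_scaleBound {p q : ℝ} (hp : 0 < p) (hpq : p < q) : Summable (scaleBound p q) := by
  refine Summable.of_nat_of_neg ?_ ?_
  · have h : Summable fun n : ℕ => ((2 : ℝ) ^ (-p)) ^ n * 2 ^ q :=
      (summable_geometric_of_lt_one (by positivity)
        (Real.rpow_lt_one_of_one_lt_of_neg one_lt_two (by linarith))).mul_right _
    refine h.congr fun n => ?_
    have h1 : (1 : ℝ) ≤ 2 ^ n := one_le_pow₀ one_le_two
    rw [scaleBound, zpow_natCast, min_eq_right h1, mul_one, ← Real.rpow_natCast, ← Real.rpow_natCast,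
      ← Real.rpow_mul zero_le_two, ← Real.rpow_mul zero_le_two, mul_comm (-p)]
  · have h : Summable fun n : ℕ => ((2 : ℝ) ^ (p - q)) ^ n * 2 ^ q :=
      (summable_geometric_of_lt_one (by positivity)
        (Real.rpow_lt_one_of_one_lt_of_neg one_lt_two (by linarith))).mul_right _
    refine h.congr fun n => ?_
    have h1 : ((2 : ℝ) ^ n)⁻¹ ≤ 1 := inv_le_one_of_one_le₀ (one_le_pow₀ one_le_two)
    rw [scaleBound, zpow_neg, zpow_natCast, min_eq_left h1,
      Real.mul_rpow zero_le_two (by positivity), ← Real.rpow_natCast, ← Real.rpow_natCast,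
      ← Real.rpow_neg zero_le_two, ← Real.rpow_mul zero_le_two, ← Real.rpow_mul zero_le_two,
      ← Real.rpow_mul zero_le_two, ← Real.rpow_add two_pos, ← Real.rpow_add two_pos,
      ← Real.rpow_add two_pos]
    ring_nf

theorem exists_zpow_two_mul_mem {d : ℝ} (hd : 0 < d) :
    ∃ k : ℤ, 1 ≤ (2 : ℝ) ^ k * d ∧ (2 : ℝ) ^ k * d ≤ 2 := by
  obtain ⟨n, h₁, h₂⟩ := exists_mem_Ico_zpow (inv_pos.2 hd) (one_lt_two (α := ℝ))
  refine ⟨n + 1, ?_, ?_⟩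
  · exact ((inv_lt_iff_one_lt_mul₀ hd).1 h₂).le
  · have : (2 : ℝ) ^ n * d ≤ 1 := by
      calc _ ≤ d⁻¹ * d := by gcongr
        _ = 1 := inv_mul_cancel₀ hd.ne'
    rw [zpow_add_one₀ two_ne_zero]
    linarith

theorem abs_snowflakeCoord_sub_rpow_le {p q : ℝ} (hp : 0 < p) (hq : 0 < q) {s t : ℝ} {k₀ : ℤ}
    (h₁ : 1 ≤ (2 : ℝ) ^ k₀ * |s - t|) (h₂ : (2 : ℝ) ^ k₀ * |s - t| ≤ 2) (k : ℤ × Bool) :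
    |snowflakeCoord p q k s - snowflakeCoord p q k t| ^ q ≤
      |s - t| ^ p * scaleBound p q (k.1 - k₀) := by
  rw [abs_snowflakeCoord_sub_rpow hq, scaleBound]
  set a : ℝ := (2 : ℝ) ^ k₀ with ha
  set c : ℝ := (2 : ℝ) ^ (k.1 - k₀) with hc
  have ha0 : 0 < a := by positivity
  have hc0 : 0 < c := by positivity
  have hk : (2 : ℝ) ^ k.1 = c * a := by
    rw [ha, hc, ← zpow_add₀ two_ne_zero, sub_add_cancel]
  rw [hk, Real.mul_rpow hc0.le ha0.le]
  have h3 : a ^ (-p) ≤ |s - t| ^ p := by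
    rw [Real.rpow_neg ha0.le, inv_le_iff_one_le_mul₀ (by positivity),
      ← Real.mul_rpow (abs_nonneg _) ha0.le, mul_comm]
    exact Real.one_le_rpow h₁ hp.le
  have h4 : |circleCoord k.2 (c * a * s) - circleCoord k.2 (c * a * t)| ≤ 2 * min c 1 := by
    rw [mul_min_of_nonneg _ _ zero_le_two, mul_one]
    refine le_min ((abs_circleCoord_sub_le _ _ _).trans ?_) (abs_circleCoord_sub_le_two _ _ _)
    rw [← mul_sub, abs_mul, abs_of_pos (by positivity)]
    nlinarith
  calc _ ≤ c ^ (-p) * |s - t| ^ p * (2 * min c 1) ^ q := by gcongr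
    _ = _ := by ring

theorem exists_le_abs_snowflakeCoord_sub_rpow {p q : ℝ} (hp : 0 < p) (hq : 0 < q) {s t : ℝ}
    {k₀ : ℤ} (h₁ : 1 ≤ (2 : ℝ) ^ k₀ * |s - t|) (h₂ : (2 : ℝ) ^ k₀ * |s - t| ≤ 2) :
    ∃ k, (1 / 2) ^ p * (1 / 2) ^ q * |s - t| ^ p ≤
      |snowflakeCoord p q k s - snowflakeCoord p q k t| ^ q := by
  have ha0 : (0 : ℝ) < (2 : ℝ) ^ k₀ := by positivity
  have h3 : |(2 : ℝ) ^ k₀ * s - (2 : ℝ) ^ k₀ * t| = (2 : ℝ) ^ k₀ * |s - t| := by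
    rw [← mul_sub, abs_mul, abs_of_pos ha0]
  obtain ⟨b, hb⟩ := exists_half_le_abs_circleCoord_sub (h3 ▸ h₁) (h3 ▸ h₂)
  refine ⟨(k₀, b), ?_⟩
  rw [abs_snowflakeCoord_sub_rpow hq]
  have h4 : (1 / 2) ^ p * |s - t| ^ p ≤ ((2 : ℝ) ^ k₀) ^ (-p) := by
    rw [← Real.mul_rpow (by norm_num) (abs_nonneg _), Real.rpow_neg ha0.le, ← Real.inv_rpow ha0.le]
    refine Real.rpow_le_rpow (by positivity) ?_ hp.le
    rw [← one_div, le_div_iff₀ ha0]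
    linarith
  calc _ = ((1 / 2) ^ p * |s - t| ^ p) * (1 / 2) ^ q := by ring
    _ ≤ _ := by gcongr

theorem exists_snowflakeCoord_bounds {p q : ℝ} (hp : 0 < p) (hpq : p < q) :
    ∃ A B : ℝ, 0 < A ∧ 0 < B ∧ ∀ s t : ℝ,
      Summable (fun k => |snowflakeCoord p q k s - snowflakeCoord p q k t| ^ q) ∧
      A * |s - t| ^ p ≤ ∑' k, |snowflakeCoord p q k s - snowflakeCoord p q k t| ^ q ∧
      ∑' k, |snowflakeCoord p q k s - snowflakeCoord p q k t| ^ q ≤ B * |s - t| ^ p := by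
  have hq : 0 < q := hp.trans hpq
  have hM : Summable fun k : ℤ × Bool => scaleBound p q k.1 := by
    simpa using (summable_scaleBound hp hpq).mul_of_nonneg
      (Summable.of_finite (f := fun _ : Bool => (1 : ℝ))) (fun j => (scaleBound_pos p q j).le)
      (fun _ => zero_le_one)
  refine ⟨(1 / 2) ^ p * (1 / 2) ^ q, ∑' k : ℤ × Bool, scaleBound p q k.1, by positivity,
    hM.tsum_pos (fun k => (scaleBound_pos p q k.1).le) (0, true) (scaleBound_pos _ _ _),
    fun s t => ?_⟩
  rcases eq_or_ne s t with rfl | hst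
  · simp [Real.zero_rpow hq.ne', Real.zero_rpow hp.ne', summable_zero]
  obtain ⟨k₀, h₁, h₂⟩ := exists_zpow_two_mul_mem (abs_pos.2 (sub_ne_zero.2 hst))
  let e : ℤ × Bool ≃ ℤ × Bool := (Equiv.subRight k₀).prodCongr (Equiv.refl _)
  have hMe : Summable fun k : ℤ × Bool => scaleBound p q (k.1 - k₀) :=
    (e.summable_iff (f := fun k : ℤ × Bool => scaleBound p q k.1)).2 hM
  have htsum : ∑' k : ℤ × Bool, scaleBound p q (k.1 - k₀) = ∑' k : ℤ × Bool, scaleBound p q k.1 :=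
    e.tsum_eq fun k : ℤ × Bool => scaleBound p q k.1
  have hle := abs_snowflakeCoord_sub_rpow_le hp hq h₁ h₂
  have hsum : Summable (fun k => |snowflakeCoord p q k s - snowflakeCoord p q k t| ^ q) :=
    Summable.of_nonneg_of_le (fun k => by positivity) hle (hMe.mul_left _)
  refine ⟨hsum, ?_, ?_⟩
  · obtain ⟨k, hk⟩ := exists_le_abs_snowflakeCoord_sub_rpow hp hq h₁ h₂
    exact hk.trans (hsum.le_tsum k fun j _ => by positivity)
  · rw [mul_comm, ← htsum, ← tsum_mul_left]
    exact hsum.tsum_le_tsum hle (hMe.mul_left _)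

/-- A two-sided comparison of the inner sums gives one for sums over a product. -/
theorem summable_prod_and_bounds {α β : Type*} {a : α × β → ℝ} {d : α → ℝ} {A B : ℝ}
    (ha : 0 ≤ a) (hd : Summable d) (hs : ∀ i, Summable fun k => a (i, k))
    (hA : ∀ i, A * d i ≤ ∑' k, a (i, k)) (hB : ∀ i, ∑' k, a (i, k) ≤ B * d i) :
    Summable a ∧ A * ∑' i, d i ≤ ∑' j, a j ∧ ∑' j, a j ≤ B * ∑' i, d i := by
  have hsum : Summable fun i => ∑' k, a (i, k) :=
    Summable.of_nonneg_of_le (fun i => tsum_nonneg fun k => ha _) hB (hd.mul_left B)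
  have hprod : Summable a := (summable_prod_of_nonneg ha).2 ⟨hs, hsum⟩
  rw [hprod.tsum_prod, ← tsum_mul_left, ← tsum_mul_left]
  exact ⟨hprod, (hd.mul_left A).tsum_le_tsum hA hsum, hsum.tsum_le_tsum hB (hd.mul_left B)⟩

/-- Theorem 1.8: for `1 ≤ p < q < ∞` there is a strong embedding
`ℓ_p → ℓ_q` (with Hölder-type two-sided estimates of exponent `p/q`) which is also
weakly sequentially continuous. -/
theorem stmt6 (p q : ℝ) (hp : 1 ≤ p) (hpq : p < q)
    [Fact (1 ≤ ENNReal.ofReal p)] [Fact (1 ≤ ENNReal.ofReal q)] :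
    ∃ (f : lp (fun _ : ℕ => ℝ) (ENNReal.ofReal p) → lp (fun _ : ℕ => ℝ) (ENNReal.ofReal q))
      (A B : ℝ), 0 < A ∧ 0 < B ∧
      (∀ x y : lp (fun _ : ℕ => ℝ) (ENNReal.ofReal p),
        A * ‖x - y‖ ^ (p / q) ≤ ‖f x - f y‖ ∧ ‖f x - f y‖ ≤ B * ‖x - y‖ ^ (p / q)) ∧
      WeakSeqCont f := by
  have hp0 : 0 < p := by linarith
  have hq0 : 0 < q := by linarith
  have hpr : (ENNReal.ofReal p).toReal = p := ENNReal.toReal_ofReal hp0.le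
  have hqr : (ENNReal.ofReal q).toReal = q := ENNReal.toReal_ofReal hq0.le
  obtain ⟨A, B, hA, hB, hAB⟩ := exists_snowflakeCoord_bounds hp0 hpq
  obtain ⟨e⟩ : Nonempty (ℕ ≃ ℕ × (ℤ × Bool)) := nonempty_equiv_of_countable
  let F (x : lp (fun _ : ℕ => ℝ) (ENNReal.ofReal p)) (n : ℕ) : ℝ :=
    snowflakeCoord p q (e n).2 (x (e n).1)
  have hF (x y : lp (fun _ : ℕ => ℝ) (ENNReal.ofReal p)) :
      Summable (fun n => |F x n - F y n| ^ q) ∧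
      A * ‖x - y‖ ^ p ≤ ∑' n, |F x n - F y n| ^ q ∧
      ∑' n, |F x n - F y n| ^ q ≤ B * ‖x - y‖ ^ p := by
    have hnorm := lp.hasSum_norm (by rwa [hpr]) (x - y)
    rw [hpr] at hnorm
    have := summable_prod_and_bounds
      (a := fun j : ℕ × (ℤ × Bool) =>
        |snowflakeCoord p q j.2 (x j.1) - snowflakeCoord p q j.2 (y j.1)| ^ q)
      (d := fun i => ‖(x - y) i‖ ^ p) (A := A) (B := B)
      (fun j => by positivity) hnorm.summable (fun i => (hAB (x i) (y i)).1)
      (fun i => (hAB (x i) (y i)).2.1) (fun i => (hAB (x i) (y i)).2.2)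
    rwa [hnorm.tsum_eq, ← e.summable_iff, ← e.tsum_eq] at this
  have hF0 : F 0 = 0 := by
    funext n
    exact snowflakeCoord_zero p q _
  let f (x : lp (fun _ : ℕ => ℝ) (ENNReal.ofReal p)) : lp (fun _ : ℕ => ℝ) (ENNReal.ofReal q) :=
    ⟨F x, memℓp_gen (by simpa [hqr, hF0] using (hF x 0).1)⟩
  have hf (x y) : ‖f x - f y‖ ^ q = ∑' n, |F x n - F y n| ^ q := by
    have := lp.norm_rpow_eq_tsum (by rwa [hqr]) (f x - f y)
    rw [hqr] at this
    exact this
  have hroot {t : ℝ} (ht : 0 ≤ t) : (t ^ q) ^ (1 / q) = t := by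
    rw [← Real.rpow_mul ht, mul_one_div_cancel hq0.ne', Real.rpow_one]
  have hpow {C t : ℝ} (hC : 0 ≤ C) (ht : 0 ≤ t) :
      (C * t ^ p) ^ (1 / q) = C ^ (1 / q) * t ^ (p / q) := by
    rw [Real.mul_rpow hC (by positivity), ← Real.rpow_mul ht, mul_one_div]
  have hbounds (x y) : A ^ (1 / q) * ‖x - y‖ ^ (p / q) ≤ ‖f x - f y‖ ∧
      ‖f x - f y‖ ≤ B ^ (1 / q) * ‖x - y‖ ^ (p / q) := by
    obtain ⟨-, h₁, h₂⟩ := hF x y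
    rw [← hf] at h₁ h₂
    rw [← hpow hA.le (norm_nonneg _), ← hpow hB.le (norm_nonneg _),
      ← hroot (norm_nonneg (f x - f y))]
    constructor <;> gcongr
  refine ⟨f, A ^ (1 / q), B ^ (1 / q), by positivity, by positivity, hbounds, ?_⟩
  intro x x₀ hx ψ
  obtain ⟨C, hC⟩ := exists_norm_le_of_tendsto_dual hx
  have hf0 : f 0 = 0 := Subtype.ext hF0
  refine lp.tendsto_dual_of_tendsto_apply (hp.trans_lt hpq) (C := B ^ (1 / q) * C ^ (p / q))
    (fun n => ?_) (fun n => ?_) ψ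
  · have := (hbounds (x n) 0).2
    rw [hf0, sub_zero, sub_zero] at this
    refine this.trans ?_
    gcongr
    exact hC n
  · exact ((continuous_snowflakeCoord p q (e n).2).tendsto _).comp
      (hx (lp.evalCLM ℝ (fun _ : ℕ => ℝ) (ENNReal.ofReal p) (e n).1))
end

section
/- Let F : [0, ∞) → [0, ∞) be a Lipschitz Orlicz function (continuous, nondecreasing, convex, F(0) = 0, not identically zero, and Lipschitz) with F(1) ≤ 1. Define a sequence of reals by a_1 = 1 and a_k = a_{k−1}·(1 + F(1/a_{k−1})) for k ≥ 2. Then for every k ≥ 1, a_k ≥ inf{λ > 0 : k·F(1/λ) ≤ 1}. -/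
/-- A convex function on `[0, ∞)` vanishing at `0` is star-shaped: `F (c t) ≤ c F t` for
`c ∈ [0, 1]`. -/
lemma ConvexOn.map_mul_le_mul_map {F : ℝ → ℝ} (hconv : ConvexOn ℝ (Set.Ici 0) F) (hF0 : F 0 = 0)
    {c t : ℝ} (hc0 : 0 ≤ c) (hc1 : c ≤ 1) (ht : 0 ≤ t) : F (c * t) ≤ c * F t := by
  have h := hconv.2 (Set.mem_Ici.2 ht) (Set.mem_Ici.2 le_rfl) hc0 (sub_nonneg.2 hc1)
    (add_sub_cancel c 1)
  simpa [hF0] using h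

/-- Lemma 3.1 / `Nkdes`: for a Lipschitz Orlicz function `F` with
`F(1) ≤ 1`, the recursively defined quantities `a_k = N_k(1,…,1)` dominate the Orlicz
norms `‖e_1 + … + e_k‖_F = inf {λ > 0 : k·F(1/λ) ≤ 1}`. -/
theorem stmt7 (F : ℝ → ℝ)
    (hcont : ContinuousOn F (Set.Ici 0))
    (hmono : MonotoneOn F (Set.Ici 0))
    (hconv : ConvexOn ℝ (Set.Ici 0) F)
    (hF0 : F 0 = 0)
    (hnonzero : ∃ t : ℝ, 0 ≤ t ∧ F t ≠ 0)
    (hnonneg : ∀ t : ℝ, 0 ≤ t → 0 ≤ F t)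
    (hlip : ∃ L : ℝ, ∀ s t : ℝ, 0 ≤ s → 0 ≤ t → |F s - F t| ≤ L * |s - t|)
    (hF1 : F 1 ≤ 1)
    (a : ℕ → ℝ)
    (ha1 : a 1 = 1)
    (hak : ∀ k : ℕ, 2 ≤ k → a k = a (k - 1) * (1 + F (1 / a (k - 1)))) :
    ∀ k : ℕ, 1 ≤ k →
      sInf { l : ℝ | 0 < l ∧ (k : ℝ) * F (1 / l) ≤ 1 } ≤ a k := by
  have key : ∀ k : ℕ, 1 ≤ k → 0 < a k ∧ (k : ℝ) * F (1 / a k) ≤ 1 := by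
    intro k hk
    induction k, hk using Nat.le_induction with
    | base => simpa [ha1] using hF1
    | succ k hk ih =>
      obtain ⟨hpos, hle⟩ := ih
      have hrec := hak (k + 1) (by lia)
      rw [Nat.add_sub_cancel] at hrec
      have hx : 0 ≤ F (1 / a k) := hnonneg _ (by positivity)
      have hstar := hconv.map_mul_le_mul_map hF0 (c := 1 / (1 + F (1 / a k))) (t := 1 / a k)
        (by positivity) ((div_le_one (by positivity)).2 (by linarith)) (by positivity)
      have harg : 1 / a (k + 1) = 1 / (1 + F (1 / a k)) * (1 / a k) := by
        rw [hrec, one_div_mul_one_div, mul_comm]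
      refine ⟨by rw [hrec]; positivity, ?_⟩
      rw [harg]
      refine (mul_le_mul_of_nonneg_left hstar (Nat.cast_nonneg _)).trans ?_
      rw [one_div_mul_eq_div, ← mul_div_assoc, div_le_one (by positivity)]
      push_cast
      linarith
  exact fun k hk => csInf_le ⟨0, fun l hl => hl.1.le⟩ (key k hk)
end

section
/- Let (e_n) be a sequence in a real normed space satisfying ‖e_{n_1} + … + e_{n_k}‖ = ‖e_1 + … + e_k‖ for all k ∈ ℕ and all n_1 < … < n_k in ℕ. Then for every k ≥ 2, ‖e_1 + … + e_k‖ ≤ (1 + 1/(k − 1))·‖e_1 + … + e_{k−1}‖. -/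
/-- Summing all the sums that omit one term counts each term `m` times. -/
theorem Fin.sum_sum_succAbove {M : Type*} [AddCommGroup M] {m : ℕ} (f : Fin (m + 1) → M) :
    ∑ j : Fin (m + 1), ∑ i, f (j.succAbove i) = m • ∑ i, f i := by
  have h (j : Fin (m + 1)) : ∑ i, f (j.succAbove i) = ∑ i, f i - f j := by
    rw [Fin.sum_univ_succAbove f j, add_sub_cancel_left]
  simp [h, Finset.sum_sub_distrib, add_smul]

/-- Lemma 3.2: if the norm of a sum of `k` distinct terms of `(e_n)`
(in increasing order) depends only on `k`, then
`‖e_1 + … + e_k‖ ≤ (1 + 1/(k-1))·‖e_1 + … + e_{k-1}‖` for all `k ≥ 2`. -/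
theorem stmt8 {S : Type*} [NormedAddCommGroup S] [NormedSpace ℝ S] (e : ℕ → S)
    (hspread : ∀ (k : ℕ) (n : Fin k → ℕ), StrictMono n →
      ‖∑ i : Fin k, e (n i)‖ = ‖∑ i ∈ Finset.range k, e i‖) :
    ∀ k : ℕ, 2 ≤ k →
      ‖∑ i ∈ Finset.range k, e i‖ ≤
        (1 + 1 / ((k : ℝ) - 1)) * ‖∑ i ∈ Finset.range (k - 1), e i‖ := by
  intro k hk
  obtain ⟨m, rfl⟩ : ∃ m, k = m + 1 := ⟨k - 1, by omega⟩
  have hm : (0 : ℝ) < m := by exact_mod_cast (by omega : 0 < m)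
  have hle : m * ‖∑ i ∈ Finset.range (m + 1), e i‖ ≤
      (m + 1) * ‖∑ i ∈ Finset.range m, e i‖ := by
    calc m * ‖∑ i ∈ Finset.range (m + 1), e i‖
        = ‖∑ j : Fin (m + 1), ∑ i, e (j.succAbove i)‖ := by
          rw [Fin.sum_sum_succAbove (fun i : Fin (m + 1) ↦ e i),
            ← Nat.cast_smul_eq_nsmul ℝ, norm_smul,
            Finset.sum_range, Real.norm_natCast]
      _ ≤ ∑ j : Fin (m + 1), ‖∑ i, e (j.succAbove i)‖ := norm_sum_le _ _
      _ = (m + 1) * ‖∑ i ∈ Finset.range m, e i‖ := by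
          simp [fun j : Fin (m + 1) ↦ hspread m (fun i ↦ j.succAbove i)
            (Fin.val_strictMono.comp (Fin.strictMono_succAbove j))]
  rw [Nat.add_sub_cancel, Nat.cast_add_one, add_sub_cancel_right, one_add_div hm.ne',
    div_mul_eq_mul_div, le_div_iff₀ hm, mul_comm]
  exact hle
end

section
/- Let X and Y be real Banach spaces, let f : X → Y be weakly sequentially continuous, and let 0 < α < β. Let (x_n) be a sequence in X which converges weakly and is [α, β]-separated, i.e. α ≤ ‖x_n − x_m‖ ≤ β for all n ≠ m. Set b = inf{‖f(x) − f(y)‖ : x, y ∈ X, α ≤ ‖x − y‖ ≤ β}, and define reals c_1, c_2, … by c_1 = b/2 and, for j ≥ 2, c_j = c_{j−1}·(1 + δ̃_Y((b/2)/c_{j−1})) if c_{j−1} > 0 and c_j = 0 if c_{j−1} = 0. Then for every k ∈ ℕ, every ε > 0, and every infinite subset M ⊆ ℕ, there exist indices m_1 < n_1 < m_2 < n_2 < … < m_k < n_k, all belonging to M, such that ‖f(x_{m_1} + … + x_{m_k}) − f(x_{n_1} + … + x_{n_k})‖ ≥ c_k − ε. -/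
open Filter

/-- `δ̃_Y(t) = ∫_0^t δ̄_Y(s)/s ds`. -/
noncomputable def tildeDelta (Y : Type*) [NormedAddCommGroup Y] [NormedSpace ℝ Y]
    (t : ℝ) : ℝ :=
  ∫ s in (0:ℝ)..t, AUCmod Y s / s

section Norm

variable {V : Type*} [NormedAddCommGroup V] [NormedSpace ℝ V]

theorem norm_add_le_norm_add_smul {x y : V} {r : ℝ} (h : ‖x‖ ≤ ‖x + y‖) (hr : 1 ≤ r) :
    ‖x + y‖ ≤ ‖x + r • y‖ := by
  have e : r • (x + y) = (r - 1) • x + (x + r • y) := by module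
  have h1 : r * ‖x + y‖ ≤ (r - 1) * ‖x‖ + ‖x + r • y‖ := by
    have := norm_add_le ((r - 1) • x) (x + r • y)
    rwa [← e, norm_smul, norm_smul, Real.norm_of_nonneg (by linarith),
      Real.norm_of_nonneg (by linarith)] at this
  nlinarith [mul_le_mul_of_nonneg_left h (sub_nonneg.2 hr)]

/-- A nonzero vector of norm at least `r - δ` can be dilated to norm at least `r` while moving it
by at most `δ`. -/
theorem exists_smul_norm_ge {z : V} (hz : z ≠ 0) {r δ : ℝ} (hδ : 0 ≤ δ) (h : r - δ ≤ ‖z‖) :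
    ∃ s : ℝ, r ≤ ‖s • z‖ ∧ ‖s • z - z‖ ≤ δ := by
  by_cases hr : r ≤ ‖z‖
  · exact ⟨1, by simpa using hr, by simpa using hδ⟩
  · have hz' : 0 < ‖z‖ := norm_pos_iff.2 hz
    have hrz : ‖z‖ < r := not_le.1 hr
    have h1 : 1 ≤ r / ‖z‖ := (one_le_div hz').2 hrz.le
    refine ⟨r / ‖z‖, ?_, ?_⟩
    · rw [norm_smul, Real.norm_of_nonneg (by linarith), div_mul_cancel₀ _ hz'.ne']
    · have e : (r / ‖z‖) • z - z = (r / ‖z‖ - 1) • z := by module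
      rw [e, norm_smul, Real.norm_of_nonneg (by linarith), sub_mul,
        div_mul_cancel₀ _ hz'.ne']
      linarith

theorem mul_le_norm_add_of_mem {E : Subspace ℝ V} {a d : V} {c h R : ℝ} (hh : 0 < h)
    (hhc : h ≤ c) (hca : c ≤ ‖a‖) (hd : d ∈ E) (hhd : h ≤ ‖d‖)
    (hE : ∀ y ∈ E, ‖a‖ ≤ ‖a + y‖)
    (hR : ∀ y ∈ E, ‖y‖ = 1 → R ≤ ‖‖a‖⁻¹ • a + (h / c) • y‖) :
    c * R ≤ ‖a + d‖ := by
  have hc : 0 < c := hh.trans_le hhc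
  have ha : 0 < ‖a‖ := hc.trans_le hca
  have hd0 : 0 < ‖d‖ := hh.trans_le hhd
  set y := (h / ‖d‖) • d with hy
  set w := (c / ‖a‖) • a with hw
  have hyE : y ∈ E := E.smul_mem _ hd
  have hyn : ‖y‖ = h := by
    rw [hy, norm_smul, Real.norm_of_nonneg (by positivity), div_mul_cancel₀ _ hd0.ne']
  have hRw : c * R ≤ ‖w + y‖ := by
    have h1 := hR (‖d‖⁻¹ • d) (E.smul_mem _ hd)
      (by rw [norm_smul, norm_inv, norm_norm, inv_mul_cancel₀ hd0.ne'])
    have e : w + y = c • (‖a‖⁻¹ • a + (h / c) • ‖d‖⁻¹ • d) := by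
      simp only [hw, hy, smul_add, smul_smul]
      congr 2
      field_simp
    rw [e, norm_smul, Real.norm_of_nonneg hc.le]
    exact mul_le_mul_of_nonneg_left h1 hc.le
  have hcw : c ≤ ‖w + y‖ := by
    have h1 := hE ((‖a‖ / c) • y) (E.smul_mem _ hyE)
    have e : w + y = (c / ‖a‖) • (a + (‖a‖ / c) • y) := by
      rw [smul_add, smul_smul, show c / ‖a‖ * (‖a‖ / c) = 1 by field_simp, one_smul]
    rw [e, norm_smul, Real.norm_of_nonneg (by positivity)]
    calc c = c / ‖a‖ * ‖a‖ := by field_simp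
      _ ≤ _ := mul_le_mul_of_nonneg_left h1 (by positivity)
  have hwa : ‖w + y‖ ≤ ‖a + y‖ := by
    have h1 := norm_add_le_norm_add_smul (x := y) (y := w) (r := ‖a‖ / c)
      (by rw [add_comm, hyn]; exact hhc.trans hcw) ((one_le_div hc).2 hca)
    have e : (‖a‖ / c) • w = a := by
      rw [hw, smul_smul, show ‖a‖ / c * (c / ‖a‖) = 1 by field_simp, one_smul]
    rwa [e, add_comm, add_comm y a] at h1
  have had : ‖a + y‖ ≤ ‖a + d‖ := by
    have h1 := norm_add_le_norm_add_smul (hE y hyE) ((one_le_div hh).2 hhd)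
    have e : (‖d‖ / h) • y = d := by
      rw [hy, smul_smul, show ‖d‖ / h * (h / ‖d‖) = 1 by field_simp, one_smul]
    rwa [e] at h1
  exact hRw.trans (hwa.trans had)

theorem le_norm_add_of_near {E : Subspace ℝ V} {a d y : V} {c h R η : ℝ} (hη : η < h)
    (hhc : h ≤ c) (hca : c ≤ ‖a‖) (hy : y ∈ E) (hdy : ‖d - y‖ ≤ η) (hhd : h ≤ ‖d‖)
    (hE : ∀ y ∈ E, ‖a‖ ≤ ‖a + y‖)
    (hR : ∀ y ∈ E, ‖y‖ = 1 → R ≤ ‖‖a‖⁻¹ • a + (h / c) • y‖) :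
    c * R - 2 * η ≤ ‖a + d‖ := by
  have hη0 : 0 ≤ η := (norm_nonneg _).trans hdy
  have hhy : h - η ≤ ‖y‖ := by
    have := norm_sub_norm_le d y
    linarith
  have hy0 : y ≠ 0 := norm_pos_iff.1 (by linarith)
  obtain ⟨s, hs, hsy⟩ := exists_smul_norm_ge hy0 hη0 hhy
  have h1 := mul_le_norm_add_of_mem (hη0.trans_lt hη) hhc hca (E.smul_mem s hy) hs hE hR
  have e : a + s • y = (a + d) - (d - y) + (s • y - y) := by abel
  have h2 := norm_add_le (a + d - (d - y)) (s • y - y)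
  have h3 := norm_sub_le (a + d) (d - y)
  rw [e] at h1
  linarith

end Norm

section Subspaces

variable {Y : Type*} [NormedAddCommGroup Y] [NormedSpace ℝ Y]

/-- For `‖x‖ = 1`, the set of lower estimates of `‖x + t y‖ - 1` over unit spheres of closed
subspaces of finite codimension, whose supremum enters `AUCmod`. -/
def aucSet (x : Y) (t : ℝ) : Set ℝ :=
  { s : ℝ | ∃ E : Subspace ℝ Y, IsClosed (E : Set Y) ∧
      FiniteDimensional ℝ (Y ⧸ E) ∧
      s = sInf { u : ℝ | ∃ y : Y, y ∈ E ∧ ‖y‖ = 1 ∧ u = ‖x + t • y‖ - 1 } }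

theorem AUCmod_eq (t : ℝ) :
    AUCmod Y t = sInf { r : ℝ | ∃ x : Y, ‖x‖ = 1 ∧ r = sSup (aucSet x t) } := rfl

theorem abs_norm_add_smul_sub_one_le {x y : Y} (hx : ‖x‖ = 1) (hy : ‖y‖ = 1) (t : ℝ) :
    |‖x + t • y‖ - 1| ≤ |t| := by
  have := abs_norm_sub_norm_le (x + t • y) x
  rwa [add_sub_cancel_left, norm_smul, hy, hx, mul_one, Real.norm_eq_abs] at this

theorem bddBelow_aucSphere {x : Y} (t : ℝ) (E : Subspace ℝ Y) :
    BddBelow { u : ℝ | ∃ y : Y, y ∈ E ∧ ‖y‖ = 1 ∧ u = ‖x + t • y‖ - 1 } := by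
  refine ⟨-1, ?_⟩
  rintro _ ⟨y, -, -, rfl⟩
  linarith [norm_nonneg (x + t • y)]

theorem bddAbove_aucSet {x : Y} (hx : ‖x‖ = 1) (t : ℝ) : BddAbove (aucSet x t) := by
  refine ⟨|t|, ?_⟩
  rintro _ ⟨E, -, -, rfl⟩
  by_cases h : ∃ y ∈ E, ‖y‖ = 1
  · obtain ⟨y, hy, hy1⟩ := h
    exact (csInf_le (bddBelow_aucSphere t E) ⟨y, hy, hy1, rfl⟩).trans
      ((le_abs_self _).trans (abs_norm_add_smul_sub_one_le hx hy1 t))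
  · rw [Set.eq_empty_of_forall_notMem (s := {u : ℝ | _})
      (by rintro _ ⟨y, hy, hy1, -⟩; exact h ⟨y, hy, hy1⟩), Real.sInf_empty]
    exact abs_nonneg t

/-- The kernel of a norming functional of `a`. -/
theorem exists_hyperplane (a : Y) : ∃ E : Subspace ℝ Y, IsClosed (E : Set Y) ∧
    FiniteDimensional ℝ (Y ⧸ E) ∧ ∀ y ∈ E, ‖a‖ ≤ ‖a + y‖ := by
  obtain ⟨φ, hφ, hφa⟩ := exists_dual_vector'' ℝ a
  refine ⟨(φ : Y →ₗ[ℝ] ℝ).ker, φ.isClosed_ker, Submodule.CoFG.ker _, ?_⟩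
  intro y hy
  have hy0 : φ y = 0 := hy
  have h1 := φ.le_opNorm (a + y)
  rw [map_add, hy0, add_zero, hφa] at h1
  have h2 : ‖φ‖ * ‖a + y‖ ≤ 1 * ‖a + y‖ := mul_le_mul_of_nonneg_right hφ (norm_nonneg _)
  simpa using h1.trans h2

theorem sSup_aucSet_nonneg {x : Y} (hx : ‖x‖ = 1) (t : ℝ) : 0 ≤ sSup (aucSet x t) := by
  obtain ⟨E, hEc, hEf, hE⟩ := exists_hyperplane x
  refine le_csSup_of_le (bddAbove_aucSet hx t) ⟨E, hEc, hEf, rfl⟩ (Real.sInf_nonneg ?_)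
  rintro _ ⟨y, hy, -, rfl⟩
  have := hE (t • y) (E.smul_mem t hy)
  linarith

theorem AUCmod_nonneg (t : ℝ) : 0 ≤ AUCmod Y t := by
  rw [AUCmod_eq]
  refine Real.sInf_nonneg ?_
  rintro _ ⟨x, hx, rfl⟩
  exact sSup_aucSet_nonneg hx t

theorem AUCmod_le {x : Y} (hx : ‖x‖ = 1) (t : ℝ) : AUCmod Y t ≤ sSup (aucSet x t) := by
  rw [AUCmod_eq]
  refine csInf_le ⟨0, ?_⟩ ⟨x, hx, rfl⟩
  rintro _ ⟨x, hx, rfl⟩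
  exact sSup_aucSet_nonneg hx t

theorem norm_add_smul_sub_one_le {x y : Y} (hx : ‖x‖ = 1) {s t : ℝ} (hs : 0 < s) (hst : s ≤ t) :
    ‖x + s • y‖ - 1 ≤ s / t * (‖x + t • y‖ - 1) := by
  have ht : 0 < t := hs.trans_le hst
  have h1 : s / t ≤ 1 := (div_le_one ht).2 hst
  have e : x + s • y = (1 - s / t) • x + (s / t) • (x + t • y) := by
    rw [smul_add, smul_smul, div_mul_cancel₀ _ ht.ne']
    module
  have h2 := norm_add_le ((1 - s / t) • x) ((s / t) • (x + t • y))
  rw [← e, norm_smul, norm_smul, hx, Real.norm_of_nonneg (by linarith),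
    Real.norm_of_nonneg (by positivity)] at h2
  linarith

theorem AUCmod_div_le {s t : ℝ} (hs : 0 < s) (hst : s ≤ t) : AUCmod Y s / s ≤ AUCmod Y t / t := by
  have ht : 0 < t := hs.trans_le hst
  have hpos : 0 < s / t := by positivity
  suffices h : AUCmod Y s ≤ s / t * AUCmod Y t by
    rw [div_le_iff₀ hs]
    calc _ ≤ _ := h
      _ = _ := by ring
  by_cases hY : ∃ x : Y, ‖x‖ = 1
  · rw [← div_le_iff₀' hpos, AUCmod_eq t]
    obtain ⟨x₁, hx₁⟩ := hY
    refine le_csInf ⟨_, x₁, hx₁, rfl⟩ ?_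
    rintro _ ⟨x, hx, rfl⟩
    rw [div_le_iff₀' hpos]
    refine (AUCmod_le hx s).trans (csSup_le ?_ ?_)
    · obtain ⟨E, hEc, hEf, -⟩ := exists_hyperplane x
      exact ⟨_, E, hEc, hEf, rfl⟩
    · rintro _ ⟨E, hEc, hEf, rfl⟩
      refine le_trans ?_ (mul_le_mul_of_nonneg_left
        (le_csSup (bddAbove_aucSet hx t) ⟨E, hEc, hEf, rfl⟩) hpos.le)
      by_cases h : ∃ y ∈ E, ‖y‖ = 1
      · obtain ⟨y₁, hy₁, hy₁n⟩ := h
        rw [← div_le_iff₀' hpos]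
        refine le_csInf ⟨_, y₁, hy₁, hy₁n, rfl⟩ ?_
        rintro _ ⟨y, hy, hyn, rfl⟩
        rw [div_le_iff₀' hpos]
        exact (csInf_le (bddBelow_aucSphere s E) ⟨y, hy, hyn, rfl⟩).trans
          (norm_add_smul_sub_one_le hx hs hst)
      · have hempty : ∀ r : ℝ,
            { u : ℝ | ∃ y : Y, y ∈ E ∧ ‖y‖ = 1 ∧ u = ‖x + r • y‖ - 1 } = ∅ := fun r =>
          Set.eq_empty_of_forall_notMem (by rintro _ ⟨y, hy, hy1, -⟩; exact h ⟨y, hy, hy1⟩)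
        rw [hempty, hempty, Real.sInf_empty, mul_zero]
  · have hzero : ∀ r : ℝ, AUCmod Y r = 0 := fun r => by
      rw [AUCmod_eq, Set.eq_empty_of_forall_notMem (s := {r : ℝ | _})
        (by rintro _ ⟨x, hx, -⟩; exact hY ⟨x, hx⟩), Real.sInf_empty]
    rw [hzero, hzero, mul_zero]

theorem tildeDelta_nonneg {t : ℝ} (ht : 0 ≤ t) : 0 ≤ tildeDelta Y t :=
  intervalIntegral.integral_nonneg ht fun s hs => div_nonneg (AUCmod_nonneg s) hs.1

theorem tildeDelta_le_AUCmod {t : ℝ} (ht : 0 < t) : tildeDelta Y t ≤ AUCmod Y t := by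
  have h := intervalIntegral.norm_integral_le_of_norm_le_const (a := 0) (b := t)
    (f := fun s => AUCmod Y s / s) (C := AUCmod Y t / t) (by
      intro s hs
      rw [Set.uIoc_of_le ht.le] at hs
      rw [Real.norm_of_nonneg (div_nonneg (AUCmod_nonneg s) hs.1.le)]
      exact AUCmod_div_le hs.1 hs.2)
  rw [sub_zero, abs_of_pos ht, div_mul_cancel₀ _ ht.ne'] at h
  exact (le_abs_self _).trans h

theorem exists_subspace_AUCmod {a : Y} (ha : a ≠ 0) (t : ℝ) {η : ℝ} (hη : 0 < η) :
    ∃ E : Subspace ℝ Y, IsClosed (E : Set Y) ∧ FiniteDimensional ℝ (Y ⧸ E) ∧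
      (∀ y ∈ E, ‖a‖ ≤ ‖a + y‖) ∧
      ∀ y ∈ E, ‖y‖ = 1 → 1 + AUCmod Y t - η ≤ ‖‖a‖⁻¹ • a + t • y‖ := by
  have hx : ‖‖a‖⁻¹ • a‖ = 1 := by
    rw [norm_smul, norm_inv, norm_norm, inv_mul_cancel₀ (norm_ne_zero_iff.2 ha)]
  obtain ⟨F, hFc, hFf, hF⟩ := exists_hyperplane a
  obtain ⟨_, ⟨G, hGc, hGf, rfl⟩, hG⟩ := exists_lt_of_lt_csSup
    (s := aucSet (‖a‖⁻¹ • a) t) (b := AUCmod Y t - η) ⟨_, F, hFc, hFf, rfl⟩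
    (by linarith [AUCmod_le hx t])
  refine ⟨F ⊓ G, hFc.inter hGc, Submodule.CoFG.inf hFf hGf, fun y hy => hF y hy.1, fun y hy hyn => ?_⟩
  have := csInf_le (bddBelow_aucSphere (x := ‖a‖⁻¹ • a) t G) ⟨y, hy.2, hyn, rfl⟩
  linarith

theorem tendsto_zero_of_weak {ι F : Type*} {l : Filter ι} [NormedAddCommGroup F] [NormedSpace ℝ F]
    [FiniteDimensional ℝ F] {w : ι → F}
    (h : ∀ φ : F →L[ℝ] ℝ, Tendsto (fun n => φ (w n)) l (nhds 0)) : Tendsto w l (nhds 0) := by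
  have B := Module.finBasis ℝ F
  have e : w = fun n => ∑ i, B.coord i (w n) • B i := by
    funext n
    simp [B.sum_repr]
  rw [e, show (0 : F) = ∑ i, (0 : ℝ) • B i by simp]
  exact tendsto_finsetSum _ fun i _ =>
    (h (LinearMap.toContinuousLinearMap (B.coord i))).smul_const (B i)

/-- A weakly null sequence eventually gets close to any closed subspace of finite codimension. -/
theorem eventually_near_of_weak {E : Subspace ℝ Y} (hEc : IsClosed (E : Set Y))
    (hEf : FiniteDimensional ℝ (Y ⧸ E)) {d : ℕ → Y} {d₀ : Y}
    (hd : ∀ ψ : Y →L[ℝ] ℝ, Tendsto (fun n => ψ (d n)) atTop (nhds (ψ d₀)))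
    {η : ℝ} (hη : 0 < η) : ∀ᶠ n in atTop, ∃ y ∈ E, ‖d n - d₀ - y‖ ≤ η := by
  have : IsClosed (E : Set Y) := hEc
  have h : Tendsto (fun n => E.mkQL (d n - d₀)) atTop (nhds 0) := by
    refine tendsto_zero_of_weak fun φ => ?_
    have := (hd (φ.comp E.mkQL)).sub_const ((φ.comp E.mkQL) d₀)
    simpa using this
  filter_upwards [(Metric.tendsto_nhds.1 h) η hη] with n hn
  rw [dist_zero_right] at hn
  obtain ⟨z, hz, hzn⟩ := Submodule.Quotient.norm_mk_lt (S := E) (E.mkQL (d n - d₀))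
    (sub_pos.2 hn)
  refine ⟨d n - d₀ - z, ?_, ?_⟩
  · exact (Submodule.Quotient.eq E).1 hz.symm
  · rw [sub_sub_cancel]
    linarith

end Subspaces

section Sequences

/-- Two points of the orbit `u + x m` are far apart, so one of them is far from any given point. -/
theorem exists_pair_far {X Y : Type*} [NormedAddCommGroup X] [NormedAddCommGroup Y]
    {f : X → Y} {α β b : ℝ} {x : ℕ → X}
    (hf : ∀ u v : X, α ≤ ‖u - v‖ → ‖u - v‖ ≤ β → b ≤ ‖f u - f v‖)
    (hsep : ∀ n m : ℕ, n ≠ m → α ≤ ‖x n - x m‖ ∧ ‖x n - x m‖ ≤ β)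
    {M : Set ℕ} (hM : M.Infinite) (N : ℕ) (u : X) (g : ℕ → Y) :
    ∃ m ∈ M, ∃ n ∈ M, N < m ∧ m < n ∧ b / 2 ≤ ‖f (u + x m) - g n‖ := by
  obtain ⟨m, hmM, hm⟩ := hM.exists_gt N
  obtain ⟨m', hm'M, hm'⟩ := hM.exists_gt m
  obtain ⟨n, hnM, hn⟩ := hM.exists_gt m'
  have hs := hsep m m' hm'.ne
  have h1 : b ≤ ‖f (u + x m) - f (u + x m')‖ :=
    hf _ _ (by simpa using hs.1) (by simpa using hs.2)
  have h2 := norm_sub_le_norm_sub_add_norm_sub (f (u + x m)) (g n) (f (u + x m'))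
  rw [norm_sub_rev (g n)] at h2
  by_cases h : b / 2 ≤ ‖f (u + x m) - g n‖
  · exact ⟨m, hmM, n, hnM, hm, hm'.trans hn, h⟩
  · exact ⟨m', hm'M, n, hnM, hm.trans hm', hn, by linarith⟩

variable {X Y : Type*} [NormedAddCommGroup X] [NormedSpace ℝ X]
  [NormedAddCommGroup Y] [NormedSpace ℝ Y]

theorem WeakSeqCont.comp_add_right {f : X → Y} (hf : WeakSeqCont f) (z : X) :
    WeakSeqCont fun u => f (u + z) := by
  intro x x₀ hx
  refine hf (fun n => x n + z) (x₀ + z) fun φ => ?_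
  simpa using (hx φ).add_const (φ z)

theorem exists_pair_extend {f : X → Y} (hwsc : WeakSeqCont f) {α β b : ℝ} {x : ℕ → X} {x₀ : X}
    (hconv : ∀ φ : X →L[ℝ] ℝ, Tendsto (fun n => φ (x n)) atTop (nhds (φ x₀)))
    (hf : ∀ u v : X, α ≤ ‖u - v‖ → ‖u - v‖ ≤ β → b ≤ ‖f u - f v‖)
    (hsep : ∀ n m : ℕ, n ≠ m → α ≤ ‖x n - x m‖ ∧ ‖x n - x m‖ ≤ β)
    (hb : 0 < b) {M : Set ℕ} (hM : M.Infinite) (N : ℕ) {c ε : ℝ} (hε : 0 < ε) (hc : b / 2 ≤ c)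
    {u v : X} (huv : c - min (ε / 4) (c / 2) ≤ ‖f (u + x₀) - f (v + x₀)‖) :
    ∃ m ∈ M, ∃ n ∈ M, N < m ∧ m < n ∧
      c * (1 + tildeDelta Y ((b / 2) / c)) - ε ≤ ‖f (u + x m) - f (v + x n)‖ := by
  have hc0 : 0 < c := by linarith
  set a₀ := f (u + x₀) - f (v + x₀) with ha₀
  have hmin1 : min (ε / 4) (c / 2) ≤ ε / 4 := min_le_left _ _
  have hmin2 : min (ε / 4) (c / 2) ≤ c / 2 := min_le_right _ _
  have ha₀0 : a₀ ≠ 0 := norm_pos_iff.1 (by linarith)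
  obtain ⟨s, hs, hsa⟩ := exists_smul_norm_ge ha₀0 (by positivity) huv
  set a := s • a₀ with ha
  obtain ⟨E, hEc, hEf, hE, hER⟩ := exists_subspace_AUCmod (norm_pos_iff.1 (hc0.trans_le hs))
    ((b / 2) / c) (show 0 < ε / (4 * c) by positivity)
  have hη : 0 < min (ε / 16) (b / 8) := by positivity
  set η := min (ε / 16) (b / 8) with hηdef
  have hη1 : η ≤ ε / 16 := min_le_left _ _
  have hη2 : η ≤ b / 8 := min_le_right _ _
  have near : ∀ w : X, ∀ᶠ n in atTop, ∃ y ∈ E, ‖f (w + x n) - f (w + x₀) - y‖ ≤ η := fun w =>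
    eventually_near_of_weak hEc hEf
      (hwsc (fun n => w + x n) (w + x₀) fun φ => by
        simpa using (hconv φ).const_add (φ w)) hη
  obtain ⟨N₀, hN₀⟩ := eventually_atTop.1 ((near u).and (near v))
  obtain ⟨m, hmM, n, hnM, hm, hmn, hfar⟩ := exists_pair_far (g := fun n => f (v + x n) + a₀)
    hf hsep hM (max N N₀) u
  obtain ⟨⟨y, hyE, hy⟩, -⟩ := hN₀ m ((le_max_right _ _).trans hm.le)
  obtain ⟨-, ⟨z, hzE, hz⟩⟩ := hN₀ n ((le_max_right _ _).trans (hm.trans hmn).le)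
  refine ⟨m, hmM, n, hnM, (le_max_left _ _).trans_lt hm, hmn, ?_⟩
  set d := f (u + x m) - (f (v + x n) + a₀) with hd
  have hdyz : ‖d - (y - z)‖ ≤ 2 * η := by
    have e : d - (y - z) = (f (u + x m) - f (u + x₀) - y) - (f (v + x n) - f (v + x₀) - z) := by
      rw [hd, ha₀]; abel
    rw [e]
    linarith [norm_sub_le (f (u + x m) - f (u + x₀) - y) (f (v + x n) - f (v + x₀) - z)]
  have key := le_norm_add_of_near (by linarith) hc hs (E.sub_mem hyE hzE) hdyz hfar hE hER
  have e : a + d = (f (u + x m) - f (v + x n)) + (a - a₀) := by rw [hd]; abel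
  have h1 := norm_add_le (f (u + x m) - f (v + x n)) (a - a₀)
  have h2 : c * (1 + tildeDelta Y (b / 2 / c)) ≤
      c * (1 + AUCmod Y (b / 2 / c) - ε / (4 * c)) + ε / 4 := by
    have h3 : c * (ε / (4 * c)) = ε / 4 := by field_simp
    have h4 := mul_le_mul_of_nonneg_left
      (tildeDelta_le_AUCmod (Y := Y) (show 0 < b / 2 / c by positivity)) hc0.le
    linarith
  rw [e] at key
  linarith

theorem exists_interlaced {x : ℕ → X} {x₀ : X}
    (hconv : ∀ φ : X →L[ℝ] ℝ, Tendsto (fun n => φ (x n)) atTop (nhds (φ x₀)))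
    {α β b : ℝ} (hb : 0 < b)
    (hsep : ∀ n m : ℕ, n ≠ m → α ≤ ‖x n - x m‖ ∧ ‖x n - x m‖ ≤ β)
    {c : ℕ → ℝ} (hc0 : c 0 = b / 2) (hc : ∀ j, b / 2 ≤ c j)
    (hcs : ∀ j, c (j + 1) = c j * (1 + tildeDelta Y ((b / 2) / c j)))
    {M : Set ℕ} (hM : M.Infinite) (k : ℕ) :
    ∀ f : X → Y, WeakSeqCont f →
      (∀ u v : X, α ≤ ‖u - v‖ → ‖u - v‖ ≤ β → b ≤ ‖f u - f v‖) → ∀ ε : ℝ, 0 < ε →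
      ∃ m n : Fin (k + 1) → ℕ,
        (∀ i, m i ∈ M) ∧ (∀ i, n i ∈ M) ∧
        (∀ i, m i < n i) ∧ (∀ i j : Fin (k + 1), i < j → n i < m j) ∧
        c k - ε ≤ ‖f (∑ i, x (m i)) - f (∑ i, x (n i))‖ := by
  induction k with
  | zero =>
    intro f _ hf ε hε
    obtain ⟨m, hm, n, hn, -, hmn, h⟩ :=
      exists_pair_far hf hsep hM 0 0 (fun n => f (0 + x n))
    refine ⟨fun _ => m, fun _ => n, fun _ => hm, fun _ => hn, fun _ => hmn, ?_, ?_⟩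
    · intro i j hij
      omega
    · simp only [zero_add] at h
      rw [Fin.sum_univ_one, Fin.sum_univ_one, hc0]
      exact le_trans (by linarith) h
  | succ k ih =>
    intro f hwsc hf ε hε
    have hck : 0 < c k := lt_of_lt_of_le (by positivity) (hc k)
    obtain ⟨m, n, hm, hn, hmn, hnm, h⟩ := ih (fun u => f (u + x₀)) (hwsc.comp_add_right x₀)
      (fun u v h1 h2 => hf _ _ (by simpa using h1) (by simpa using h2))
      (min (ε / 4) (c k / 2)) (by positivity)
    obtain ⟨p, hp, q, hq, hNp, hpq, hfar⟩ := exists_pair_extend hwsc hconv hf hsep hb hM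
      (n (Fin.last k)) hε (hc k) h
    have hlast : ∀ i, n i < p := fun i => by
      refine lt_of_le_of_lt ?_ hNp
      rcases (Fin.le_last i).eq_or_lt with rfl | hi
      · exact le_rfl
      · exact ((hnm _ _ hi).trans (hmn _)).le
    refine ⟨Fin.snoc m p, Fin.snoc n q, ?_, ?_, ?_, ?_, ?_⟩
    · exact Fin.lastCases (by simpa using hp) fun i => by simpa using hm i
    · exact Fin.lastCases (by simpa using hq) fun i => by simpa using hn i
    · exact Fin.lastCases (by simpa using hpq) fun i => by simpa using hmn i
    · intro i j
      refine Fin.lastCases ?_ (fun j => ?_) j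
      · refine Fin.lastCases (fun h => absurd h (lt_irrefl _)) (fun i _ => ?_) i
        simpa using hlast i
      · refine Fin.lastCases (fun h => absurd h (Fin.le_last _).not_gt) (fun i h => ?_) i
        simpa using hnm i j (by simpa using h)
    · rw [Fin.sum_univ_castSucc (n := k + 1), Fin.sum_univ_castSucc (n := k + 1), hcs]
      simpa only [Fin.snoc_castSucc, Fin.snoc_last] using hfar

end Sequences

/-- Lemma 3.4 / `lemmaGenNOVO`: quantitative lower bound
`N_k(b/2,…,b/2) − ε` for the displacement of `f` along interlaced sums of an
`[α,β]`-separated weakly convergent sequence, where `f` is weakly sequentially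
continuous. -/
theorem stmt9 {X Y : Type*} [NormedAddCommGroup X] [NormedSpace ℝ X] [CompleteSpace X]
    [NormedAddCommGroup Y] [NormedSpace ℝ Y] [CompleteSpace Y]
    (f : X → Y) (hwsc : WeakSeqCont f)
    (α β : ℝ) (hα : 0 < α) (hαβ : α < β)
    (x : ℕ → X) (x₀ : X)
    (hconv : ∀ φ : X →L[ℝ] ℝ, Tendsto (fun n => φ (x n)) atTop (nhds (φ x₀)))
    (hsep : ∀ n m : ℕ, n ≠ m → α ≤ ‖x n - x m‖ ∧ ‖x n - x m‖ ≤ β)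
    (b : ℝ)
    (hb : b = sInf { r : ℝ | ∃ u v : X,
      (α ≤ ‖u - v‖ ∧ ‖u - v‖ ≤ β) ∧ r = ‖f u - f v‖ })
    (c : ℕ → ℝ) (hc1 : c 1 = b / 2)
    (hc : ∀ j : ℕ, 2 ≤ j →
      (0 < c (j - 1) → c j = c (j - 1) * (1 + tildeDelta Y ((b / 2) / c (j - 1)))) ∧
      (c (j - 1) = 0 → c j = 0)) :
    ∀ k : ℕ, 1 ≤ k → ∀ ε : ℝ, 0 < ε → ∀ M : Set ℕ, M.Infinite →
      ∃ m n : Fin k → ℕ,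
        (∀ i, m i ∈ M) ∧ (∀ i, n i ∈ M) ∧
        (∀ i, m i < n i) ∧ (∀ i j : Fin k, i < j → n i < m j) ∧
        c k - ε ≤ ‖f (∑ i : Fin k, x (m i)) - f (∑ i : Fin k, x (n i))‖ := by
  have hb0 : 0 ≤ b := by
    rw [hb]
    refine Real.sInf_nonneg ?_
    rintro _ ⟨u, v, -, rfl⟩
    exact norm_nonneg _
  intro k hk ε hε M hM
  obtain ⟨k, rfl⟩ : ∃ l, k = l + 1 := ⟨k - 1, by omega⟩
  rcases hb0.eq_or_lt with hb0 | hb0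
  · have hzero : ∀ j, c (j + 1) = 0 := by
      intro j
      induction j with
      | zero => rw [hc1, ← hb0, zero_div]
      | succ j ih => exact (hc (j + 2) (by omega)).2 ih
    have hmono : StrictMono (Nat.nth (· ∈ M)) := Nat.nth_strictMono hM
    refine ⟨fun i => Nat.nth (· ∈ M) (2 * i), fun i => Nat.nth (· ∈ M) (2 * i + 1),
      fun i => Nat.nth_mem_of_infinite hM _, fun i => Nat.nth_mem_of_infinite hM _,
      fun i => hmono (Nat.lt_succ_self _), fun i j hij => hmono ?_, ?_⟩
    · have : (i : ℕ) < j := hij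
      omega
    · rw [hzero]
      exact le_trans (by linarith) (norm_nonneg _)
  · have hge : ∀ j, b / 2 ≤ c (j + 1) ∧
        c (j + 2) = c (j + 1) * (1 + tildeDelta Y ((b / 2) / c (j + 1))) := by
      intro j
      have hstep : b / 2 ≤ c (j + 1) →
          c (j + 2) = c (j + 1) * (1 + tildeDelta Y ((b / 2) / c (j + 1))) :=
        fun h => (hc (j + 2) (by omega)).1 (lt_of_lt_of_le (by positivity) h)
      suffices h : b / 2 ≤ c (j + 1) from ⟨h, hstep h⟩
      clear hstep
      induction j with
      | zero => rw [hc1]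
      | succ j ih =>
        have hpos : 0 < c (j + 1) := lt_of_lt_of_le (by positivity) ih
        have hδ := tildeDelta_nonneg (Y := Y) (show 0 ≤ (b / 2) / c (j + 1) by positivity)
        have := (hc (j + 2) (by omega)).1 hpos
        rw [show j + 2 - 1 = j + 1 from rfl] at this
        rw [show j + 1 + 1 = j + 2 from rfl, this]
        nlinarith [mul_nonneg hpos.le hδ]
    refine exists_interlaced hconv hb0 hsep (c := fun j => c (j + 1)) hc1 (fun j => (hge j).1)
      (fun j => (hge j).2) hM k f hwsc (fun u v h1 h2 => ?_) ε hε
    rw [hb]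
    refine csInf_le ⟨0, ?_⟩ ⟨u, v, ⟨h1, h2⟩, rfl⟩
    rintro _ ⟨u, v, -, rfl⟩
    exact norm_nonneg _
end

section
/- Let X and Y be real Banach spaces and let p ∈ [1, ∞). Assume Y satisfies asymptotic lower ℓ_p-estimates: there exists C > 0 such that for every k ∈ ℕ there is a function σ assigning to each finite sequence (y_1, …, y_j) of elements of Y with 0 ≤ j < k a closed linear subspace σ(y_1, …, y_j) of Y of finite codimension, with the property that whenever y_1, …, y_k ∈ Y satisfy ‖y_i‖ = 1 and y_i ∈ σ(y_1, …, y_{i−1}) for each i = 1, …, k, then ‖Σ_{i=1}^k a_i y_i‖ ≥ C·(Σ_{i=1}^k |a_i|^p)^{1/p} for all reals a_1, …, a_k. Assume there exists a map f : X → Y which is weakly sequentially continuous, coarse, and satisfies Property (*). Then X has the p-co-Banach-Saks property. -/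
open Filter

universe v

/-- `X` has the `p`-co-Banach-Saks property. -/
def pCoBanachSaks (X : Type*) [NormedAddCommGroup X] [NormedSpace ℝ X] (p : ℝ) : Prop :=
  ∃ C : ℝ, 0 < C ∧
    ∀ x : ℕ → X, (∀ n, ‖x n‖ = 1) →
      (∀ φ : X →L[ℝ] ℝ, Tendsto (fun n => φ (x n)) atTop (nhds 0)) →
      ∀ (S : Type v) [NormedAddCommGroup S] [NormedSpace ℝ S] [CompleteSpace S]
        (e : ℕ → S), IsSpreadingModel x e →
        ∀ k : ℕ, C * (k : ℝ) ^ (1 / p) ≤ ‖∑ i : Fin k, e (i : ℕ)‖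

/-- A weakly null sequence converges to zero in norm modulo any closed subspace of finite
codimension, so it is eventually close to that subspace. -/
theorem eventually_exists_mem_norm_sub_lt_of_weaklyNull {Y : Type*} [NormedAddCommGroup Y]
    [NormedSpace ℝ Y] (E : Subspace ℝ Y) (hE : IsClosed (E : Set Y))
    [FiniteDimensional ℝ (Y ⧸ E)] (y : ℕ → Y)
    (hy : ∀ ψ : Y →L[ℝ] ℝ, Tendsto (fun n => ψ (y n)) atTop (nhds 0)) {ε : ℝ} (hε : 0 < ε) :
    ∀ᶠ n in atTop, ∃ u ∈ E, ‖u - y n‖ < ε := by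
  have : IsClosed (E : Set Y) := hE
  let b := Module.finBasis ℝ (Y ⧸ E)
  let g := b.equivFun.toContinuousLinearEquiv
  have hg : Tendsto (fun n => g (E.mkQL (y n))) atTop (nhds 0) := by
    rw [tendsto_pi_nhds]
    intro i
    exact hy ((ContinuousLinearMap.proj (R := ℝ) (φ := fun _ => ℝ) i).comp
      ((g : (Y ⧸ E) →L[ℝ] (Fin _ → ℝ)).comp E.mkQL))
  have hq : Tendsto (fun n => E.mkQL (y n)) atTop (nhds 0) := by
    have := (g.symm.continuous.tendsto 0).comp hg
    simpa [Function.comp_def] using this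
  have hn := hq.norm
  rw [norm_zero] at hn
  filter_upwards [hn.eventually (gt_mem_nhds hε)] with n hn'
  obtain ⟨m, hm, hlt⟩ := Submodule.Quotient.norm_mk_lt (S := E) (E.mkQL (y n))
    (sub_pos.mpr hn')
  refine ⟨y n - m, ?_, ?_⟩
  · rw [← Submodule.Quotient.eq]
    exact hm.symm
  · rw [sub_sub_cancel_left, norm_neg]
    linarith

/-- A coarse map on a normed space is Lipschitz at large distances. -/
theorem Coarse.exists_norm_sub_le {X Y : Type*} [NormedAddCommGroup X] [NormedSpace ℝ X]
    [NormedAddCommGroup Y] {f : X → Y} (hf : Coarse f) :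
    ∃ L : ℝ, 0 ≤ L ∧ ∀ x : X, ‖f x - f 0‖ ≤ L * (‖x‖ + 1) := by
  obtain ⟨L, hL⟩ := hf 1 zero_le_one
  have hL0 : 0 ≤ L := by simpa using hL 0 0 (by simp)
  refine ⟨L, hL0, fun x => ?_⟩
  have key : ∀ (v : X), ‖v‖ ≤ 1 → ∀ n : ℕ, ‖f ((n : ℝ) • v) - f 0‖ ≤ n * L := by
    intro v hv n
    induction n with
    | zero => simp
    | succ n ih =>
      have h1 := hL (((n + 1 : ℕ) : ℝ) • v) ((n : ℝ) • v) (by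
        rw [← sub_smul]; simpa using hv)
      have h2 := norm_sub_le_norm_sub_add_norm_sub (f (((n + 1 : ℕ) : ℝ) • v))
        (f ((n : ℝ) • v)) (f 0)
      push_cast at *
      linarith
  set n := ⌊‖x‖⌋₊ + 1
  have hn : (0 : ℝ) < n := by positivity
  have hxn : ‖x‖ ≤ n := by simpa [n] using (Nat.lt_floor_add_one ‖x‖).le
  have hnx : (n : ℝ) ≤ ‖x‖ + 1 := by
    simpa [n] using Nat.floor_le (norm_nonneg x)
  have h := key ((n : ℝ)⁻¹ • x) (by
    rw [norm_smul, norm_inv, Real.norm_natCast, inv_mul_le_iff₀ hn]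
    simpa using hxn) n
  rw [smul_inv_smul₀ hn.ne'] at h
  nlinarith

/-- The sum of the first `k ≥ 1` vectors of a spreading model of a normalized weakly null
sequence is bounded away from zero. -/
theorem IsSpreadingModel.one_le_two_mul_norm_sum {X S : Type*} [NormedAddCommGroup X]
    [NormedSpace ℝ X] [NormedAddCommGroup S] [NormedSpace ℝ S] {x : ℕ → X} {e : ℕ → S}
    (hx : ∀ n, ‖x n‖ = 1)
    (hx0 : ∀ φ : X →L[ℝ] ℝ, Tendsto (fun n => φ (x n)) atTop (nhds 0))
    (he : IsSpreadingModel x e) {k : ℕ} (hk : k ≠ 0) :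
    1 ≤ 2 * ‖∑ i : Fin k, e (i : ℕ)‖ := by
  obtain ⟨k, rfl⟩ := Nat.exists_eq_succ_of_ne_zero hk
  set ε : ℝ := 1 / (2 * (k + 1))
  have hε : 0 < ε := by positivity
  have hkε : (k + 1) * ε = 1 / 2 := by simp only [ε]; field_simp
  obtain ⟨l, hl⟩ := he ε hε (k + 1)
  obtain ⟨φ, hφ, hφx⟩ := exists_dual_vector ℝ (x l) (by
    rw [hx]; exact one_ne_zero)
  obtain ⟨N, hN⟩ := eventually_atTop.1 ((hx0 φ).eventually (lt_mem_nhds (neg_lt_zero.2 hε)))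
  have h := hl (Fin.cons l fun i : Fin k => max N (l + 1) + i) (by
      rw [Fin.strictMono_iff_lt_succ]
      intro i
      cases k with
      | zero => exact i.elim0
      | succ k =>
        refine Fin.cases ?_ (fun j => ?_) i
        · simp
        · rw [← Fin.succ_castSucc]
          simp)
    (fun i => Fin.cases (by simp) (fun j => by simp; omega) i) (fun _ => 1) (by simp)
  simp only [one_smul, Fin.sum_univ_succ (f := fun i => x _), Fin.cons_zero,
    Fin.cons_succ] at h
  have h1 : 1 - k * ε ≤ φ (x l + ∑ i : Fin k, x (max N (l + 1) + i)) := by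
    have h2 : ∑ i : Fin k, (-ε) ≤ ∑ i : Fin k, φ (x (max N (l + 1) + i)) :=
      Finset.sum_le_sum fun i _ => (hN _ (by omega)).le
    rw [map_add, map_sum, hφx, hx]
    simp at h2 ⊢
    linarith
  have h3 := (le_abs_self _).trans (φ.le_opNorm (x l + ∑ i : Fin k, x (max N (l + 1) + i)))
  rw [hφ, one_mul] at h3
  have h4 := (abs_le.1 h).2
  linarith

/-- Along a normalized weakly null sequence, a weakly sequentially continuous map with a uniform
lower bound on distances `α` has increments that approximately follow any strategy choosing closed
subspaces of finite codimension. -/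
theorem WeakSeqCont.exists_strategy_run {X Y : Type*} [NormedAddCommGroup X] [NormedSpace ℝ X]
    [NormedAddCommGroup Y] [NormedSpace ℝ Y] {f : X → Y} (hf : WeakSeqCont f)
    {α b ε : ℝ} (hα : 0 < α) (hε : 0 < ε) (hεb : ε ≤ b / 2)
    (hb : ∀ x y : X, ‖x - y‖ = α → b ≤ ‖f x - f y‖) {x : ℕ → X} (hx : ∀ n, ‖x n‖ = 1)
    (hx0 : ∀ φ : X →L[ℝ] ℝ, Tendsto (fun n => φ (x n)) atTop (nhds 0)) {k : ℕ}
    (σ : ∀ j : ℕ, (Fin j → Y) → Subspace ℝ Y)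
    (hσ : ∀ (j : ℕ) (ys : Fin j → Y), j < k →
      IsClosed ((σ j ys : Set Y)) ∧ FiniteDimensional ℝ (Y ⧸ σ j ys)) (l : ℕ) :
    ∀ j ≤ k, ∃ (n : ℕ → ℕ) (w : ℕ → Y) (a : ℕ → ℝ),
      (∀ i < j, l ≤ n i ∧ (∀ i' < i, n i' < n i) ∧ ‖w i‖ = 1 ∧ b / 2 ≤ a i ∧
        w i ∈ σ i (fun t : Fin i => w t)) ∧
      ‖∑ i ∈ Finset.range j, a i • w i - (f (α • ∑ i ∈ Finset.range j, x (n i)) - f 0)‖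
        ≤ j * ε := by
  intro j
  induction j with
  | zero => exact fun _ => ⟨fun _ => 0, fun _ => 0, fun _ => 0, by simp, by simp⟩
  | succ j ih =>
    intro hj
    obtain ⟨n, w, a, h, hsum⟩ := ih (by omega)
    set z := α • ∑ i ∈ Finset.range j, x (n i)
    set E := σ j (fun t : Fin j => w t)
    obtain ⟨hE, hfin⟩ := hσ j (fun t : Fin j => w t) (by omega)
    have hweak : ∀ ψ : Y →L[ℝ] ℝ,
        Tendsto (fun m => ψ (f (z + α • x m) - f z)) atTop (nhds 0) := by
      intro ψ
      have := hf (fun m => z + α • x m) z (fun φ => by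
        simpa using ((hx0 φ).const_mul α).const_add (φ z)) ψ
      simpa using this.sub_const (ψ (f z))
    obtain ⟨m, ⟨u, huE, hu⟩, hlm, hnm⟩ :=
      ((eventually_exists_mem_norm_sub_lt_of_weaklyNull E hE _ hweak hε).and
        ((eventually_ge_atTop l).and
          (eventually_gt_atTop (∑ i ∈ Finset.range j, n i)))).exists
    have hbf : b ≤ ‖f (z + α • x m) - f z‖ :=
      hb _ _ (by rw [add_sub_cancel_left, norm_smul, hx, mul_one, Real.norm_of_nonneg hα.le])
    have hub : b / 2 ≤ ‖u‖ := by
      have := norm_sub_norm_le (f (z + α • x m) - f z) u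
      rw [norm_sub_rev _ u] at this
      linarith
    have hu0 : ‖u‖ ≠ 0 := by linarith
    have hrestrict : ∀ i ≤ j, (fun t : Fin i => Function.update w j (‖u‖⁻¹ • u) t) =
        fun t : Fin i => w t := fun i hi => funext fun t =>
      Function.update_of_ne (by have := t.2; omega) _ _
    refine ⟨Function.update n j m, Function.update w j (‖u‖⁻¹ • u),
      Function.update a j ‖u‖, fun i hi => ?_, ?_⟩
    · rw [hrestrict i (by omega)]
      rcases Nat.lt_succ_iff_lt_or_eq.1 hi with hi | rfl
      · have hn' : ∀ i' < i, Function.update n j m i' = n i' := fun i' hi' =>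
          Function.update_of_ne (by omega) _ _
        simp only [Function.update_of_ne hi.ne]
        refine ⟨(h i hi).1, fun i' hi' => ?_, (h i hi).2.2⟩
        rw [hn' i' hi']
        exact (h i hi).2.1 i' hi'
      · simp only [Function.update_self]
        refine ⟨hlm, fun i' hi' => ?_, ?_, hub, E.smul_mem _ huE⟩
        · rw [Function.update_of_ne hi'.ne]
          exact (Finset.single_le_sum (fun _ _ => Nat.zero_le _)
            (Finset.mem_range.2 hi')).trans_lt hnm
        · rw [norm_smul, norm_inv, norm_norm, inv_mul_cancel₀ hu0]
    · have h1 : ∑ i ∈ Finset.range j, Function.update a j ‖u‖ i •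
          Function.update w j (‖u‖⁻¹ • u) i = ∑ i ∈ Finset.range j, a i • w i :=
        Finset.sum_congr rfl fun i hi => by
          simp only [Function.update_of_ne (Finset.mem_range.1 hi).ne]
      have h2 : ∑ i ∈ Finset.range j, x (Function.update n j m i) =
          ∑ i ∈ Finset.range j, x (n i) :=
        Finset.sum_congr rfl fun i hi => by
          simp only [Function.update_of_ne (Finset.mem_range.1 hi).ne]
      rw [Finset.sum_range_succ, Finset.sum_range_succ, h1, h2, smul_add]
      simp only [Function.update_self, smul_inv_smul₀ hu0]
      calc _ = ‖(∑ i ∈ Finset.range j, a i • w i - (f z - f 0)) +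
              (u - (f (z + α • x m) - f z))‖ := by congr 1; abel
        _ ≤ j * ε + ε := (norm_add_le _ _).trans (add_le_add hsum hu.le)
        _ = _ := by push_cast; ring

/-- Theorem 3.7 / `ThmAsymp`: if `Y` satisfies asymptotic lower
`ℓ_p`-estimates (via winning strategies `σ` of Player I in the asymptotic game) and
there is a weakly sequentially continuous coarse map `X → Y` with Property (*), then
`X` has the `p`-co-Banach-Saks property. -/
theorem stmt10 {X Y : Type*} [NormedAddCommGroup X] [NormedSpace ℝ X] [CompleteSpace X]
    [NormedAddCommGroup Y] [NormedSpace ℝ Y] [CompleteSpace Y]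
    (p : ℝ) (hp : 1 ≤ p)
    (hY : ∃ C : ℝ, 0 < C ∧ ∀ k : ℕ,
      ∃ σ : ∀ j : ℕ, (Fin j → Y) → Subspace ℝ Y,
        (∀ (j : ℕ) (ys : Fin j → Y), j < k →
          IsClosed ((σ j ys : Set Y)) ∧ FiniteDimensional ℝ (Y ⧸ σ j ys)) ∧
        ∀ y : Fin k → Y,
          (∀ i : Fin k, ‖y i‖ = 1 ∧
            y i ∈ σ i.val (fun j : Fin i.val => y ⟨j.val, j.isLt.trans i.isLt⟩)) →
          ∀ a : Fin k → ℝ,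
            C * (∑ i : Fin k, |a i| ^ p) ^ (1 / p) ≤ ‖∑ i : Fin k, a i • y i‖)
    (f : X → Y) (hwsc : WeakSeqCont f) (hcoarse : Coarse f) (hstar : PropertyStar f) :
    pCoBanachSaks.{v} X p := by
  obtain ⟨C, hC, hY⟩ := hY
  obtain ⟨α, β, b, hα, hαβ, hb, hstar⟩ := hstar
  obtain ⟨L, hL0, hL⟩ := hcoarse.exists_norm_sub_le
  have hD : 0 < 3 * L * α + 2 * L + 2 := by positivity
  refine ⟨C * (b / 2) / (3 * L * α + 2 * L + 2), by positivity, ?_⟩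
  intro x hx hx0 S _ _ _ e he k
  have hp0 : 0 < p := by linarith
  rcases eq_or_ne k 0 with rfl | hk
  · simp [Real.zero_rpow (inv_pos.2 hp0).ne']
  have hM := he.one_le_two_mul_norm_sum hx hx0 hk
  set M := ‖∑ i : Fin k, e (i : ℕ)‖
  obtain ⟨σ, hσ, hwin⟩ := hY k
  obtain ⟨l, hl⟩ := he (1 / 2) (by norm_num) k
  have hk0 : (0 : ℝ) < k := by positivity
  obtain ⟨n, w, a, h, hsum⟩ := hwsc.exists_strategy_run (ε := min (b / 2) (1 / k)) hα
    (by positivity) (min_le_left _ _) (fun u v huv => hstar u v huv.ge (huv.le.trans hαβ.le))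
    hx hx0 σ hσ l k le_rfl
  have hkε : k * min (b / 2) (1 / (k : ℝ)) ≤ 1 :=
    (mul_le_mul_of_nonneg_left (min_le_right _ _) hk0.le).trans (by field_simp; rfl)
  have hnorm := hl (fun i => n i) (fun i i' hii => (h i' i'.2).2.1 i hii)
    (fun i => (h i i.2).1) (fun _ => 1) (by simp)
  have hlow := hwin (fun i => w i) (fun i => ⟨(h i i.2).2.2.1, (h i i.2).2.2.2.2⟩)
    (fun i => a i)
  simp only [one_smul, Fin.sum_univ_eq_sum_range (fun i => x (n i))] at hnorm
  rw [Fin.sum_univ_eq_sum_range (fun i => a i • w i)] at hlow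
  have hpow : b / 2 * (k : ℝ) ^ (1 / p) ≤ (∑ i : Fin k, |a i| ^ p) ^ (1 / p) := by
    have h1 : k * (b / 2) ^ p ≤ ∑ i : Fin k, |a i| ^ p := by
      have : ∑ _i : Fin k, (b / 2) ^ p ≤ ∑ i : Fin k, |a i| ^ p :=
        Finset.sum_le_sum fun i _ => Real.rpow_le_rpow (by positivity)
          ((h i i.2).2.2.2.1.trans (le_abs_self _)) hp0.le
      simpa using this
    calc b / 2 * (k : ℝ) ^ (1 / p) = (k * (b / 2) ^ p) ^ (1 / p) := by
          rw [Real.mul_rpow hk0.le (by positivity), ← Real.rpow_mul (by positivity),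
            mul_one_div_cancel hp0.ne', Real.rpow_one, mul_comm]
      _ ≤ _ := Real.rpow_le_rpow (by positivity) h1 (by positivity)
  have hup := hL (α • ∑ i ∈ Finset.range k, x (n i))
  rw [norm_smul, Real.norm_of_nonneg hα.le] at hup
  have hxM : ‖∑ i ∈ Finset.range k, x (n i)‖ ≤ M + 1 / 2 := by
    have := (abs_le.1 hnorm).2
    linarith
  have hfin := norm_sub_norm_le (∑ i ∈ Finset.range k, a i • w i)
    (f (α • ∑ i ∈ Finset.range k, x (n i)) - f 0)
  have hCpow := mul_le_mul_of_nonneg_left hpow hC.le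
  have hxM' : L * (α * ‖∑ i ∈ Finset.range k, x (n i)‖ + 1) ≤ L * (α * (2 * M) + 2 * M) := by
    gcongr
    linarith
  rw [div_mul_eq_mul_div, div_le_iff₀ hD]
  have : 0 ≤ L * α * M := by positivity
  linarith
end

section
/- Let X be a real Banach space, let q ∈ (1, ∞), let (Y_n)_{n ∈ ℕ} be a family of real Banach spaces, and for each n let f_n : X → Y_n be a continuous map for which there exists a finite-rank bounded linear operator P_n : X → X with f_n(x) = f_n(P_n(x)) for all x ∈ X. Assume that for every x ∈ X one has Σ_n ‖f_n(x)‖^q < ∞, so that f(x) := (f_n(x))_n defines a map f from X into the ℓ_q-sum (⊕_n Y_n)_{ℓ_q}, and assume f is coarse. Then f is weakly sequentially continuous. -/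
open Filter

/-- A weakly convergent sequence stays at bounded distance from its limit. -/
theorem exists_norm_sub_le_of_weak_tendsto {X : Type*} [NormedAddCommGroup X] [NormedSpace ℝ X]
    {x : ℕ → X} {x₀ : X}
    (hx : ∀ φ : X →L[ℝ] ℝ, Tendsto (fun n => φ (x n)) atTop (nhds (φ x₀))) :
    ∃ C : ℝ, 0 ≤ C ∧ ∀ n, ‖x n - x₀‖ ≤ C := by
  have hbd : ∃ C, ∀ n, ‖NormedSpace.inclusionInDoubleDual ℝ X (x n - x₀)‖ ≤ C := by
    refine banach_steinhaus fun φ => ?_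
    obtain ⟨C, hC⟩ := (((hx φ).sub_const (φ x₀)).norm).bddAbove_range
    refine ⟨C, fun n => ?_⟩
    rw [NormedSpace.dual_def, map_sub]
    exact hC ⟨n, rfl⟩
  obtain ⟨C, hC⟩ := hbd
  have hC' (n : ℕ) : ‖x n - x₀‖ ≤ C := by
    rw [← (NormedSpace.inclusionInDoubleDualLi (E := X) ℝ).norm_map]
    exact hC n
  exact ⟨C, (norm_nonneg _).trans (hC' 0), hC'⟩

/-- A finite-rank bounded operator maps weakly convergent sequences to norm convergent ones. -/
theorem tendsto_apply_of_weak_tendsto_of_finiteDimensional_range {X Z : Type*}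
    [NormedAddCommGroup X] [NormedSpace ℝ X] [NormedAddCommGroup Z] [NormedSpace ℝ Z]
    {x : ℕ → X} {x₀ : X}
    (hx : ∀ φ : X →L[ℝ] ℝ, Tendsto (fun n => φ (x n)) atTop (nhds (φ x₀)))
    (P : X →L[ℝ] Z) [FiniteDimensional ℝ (LinearMap.range (P : X →ₗ[ℝ] Z))] :
    Tendsto (fun n => P (x n)) atTop (nhds (P x₀)) := by
  let Q : X →L[ℝ] LinearMap.range (P : X →ₗ[ℝ] Z) := P.codRestrict _ fun y => ⟨y, rfl⟩
  let e := (Module.finBasis ℝ (LinearMap.range (P : X →ₗ[ℝ] Z))).equivFunL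
  have he : Tendsto (fun n => e (Q (x n))) atTop (nhds (e (Q x₀))) :=
    tendsto_pi_nhds.2 fun i => hx ((ContinuousLinearMap.proj i).comp (e.toContinuousLinearMap.comp Q))
  have hQ := (e.symm.continuous.tendsto _).comp he
  simp only [Function.comp_def, ContinuousLinearEquiv.symm_apply_apply] at hQ
  exact (continuous_subtype_val.tendsto _).comp hQ

section lp

variable {ι : Type*} [DecidableEq ι] {E : ι → Type*} [∀ i, NormedAddCommGroup (E i)]
  {p : ENNReal}

/-- The `p`-th power of the norm is additive on a truncation and a vector supported off it. -/
theorem lp.norm_sum_single_add_rpow (hp : 0 < p.toReal) (f v : lp E p) (s : Finset ι)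
    (hv : ∀ i ∈ s, v i = 0) :
    ‖∑ i ∈ s, lp.single p i (f i) + v‖ ^ p.toReal = ∑ i ∈ s, ‖f i‖ ^ p.toReal + ‖v‖ ^ p.toReal := by
  have hcoord : ∀ i ∈ s, (∑ j ∈ s, lp.single p j (f j) + v : lp E p) i = f i := by
    intro i hi
    simp only [lp.coeFn_add, lp.coeFn_sum, lp.coeFn_single, Pi.add_apply, Finset.sum_apply,
      Finset.sum_pi_single, if_pos hi, hv i hi, add_zero]
  have h := lp.norm_sub_norm_compl_sub_single hp (∑ i ∈ s, lp.single p i (f i) + v) s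
  have htrunc : ∑ i ∈ s, lp.single p i ((∑ j ∈ s, lp.single p j (f j) + v : lp E p) i) =
      ∑ i ∈ s, lp.single p i (f i) :=
    Finset.sum_congr rfl fun i hi => by rw [hcoord i hi]
  rw [htrunc, add_sub_cancel_left,
    Finset.sum_congr (g := fun i => ‖f i‖ ^ p.toReal) rfl fun i hi => by rw [hcoord i hi]] at h
  linarith

variable [∀ i, NormedSpace ℝ (E i)] [Fact (1 ≤ p)]

/-- For `1 < p < ∞`, a bounded functional on `lp E p` is uniformly small on the vectors of a ball
which vanish on a suitable finite set of coordinates. -/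
theorem lp.exists_finset_abs_apply_le (hp : 1 < p.toReal) (ψ : lp E p →L[ℝ] ℝ) (C : ℝ) {ε : ℝ}
    (hε : 0 < ε) :
    ∃ s : Finset ι, ∀ v : lp E p, (∀ i ∈ s, v i = 0) → ‖v‖ ≤ C → |ψ v| ≤ ε := by
  set q := p.toReal
  have hq : 0 < q := zero_lt_one.trans hp
  have hp_top : p ≠ ⊤ := fun h => by simp [q, h] at hq
  obtain ⟨t, ht, htε⟩ : ∃ t : ℝ, 0 < t ∧ ‖ψ‖ * (t ^ (q - 1) * C ^ q) < ε / 2 := by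
    have hlim : Tendsto (fun t : ℝ => ‖ψ‖ * (t ^ (q - 1) * C ^ q)) (nhdsWithin 0 (Set.Ioi 0))
        (nhds 0) := by
      have h := (((Real.continuousAt_rpow_const 0 (q - 1) (Or.inr (by linarith))).tendsto).mul_const
        (C ^ q)).const_mul ‖ψ‖
      rw [Real.zero_rpow (by linarith), zero_mul, mul_zero] at h
      exact h.mono_left nhdsWithin_le_nhds
    exact (eventually_mem_nhdsWithin.and (hlim.eventually (gt_mem_nhds (half_pos hε)))).exists
  obtain ⟨w, hw, hψw⟩ : ∃ w : lp E p, ‖w‖ ≤ 1 ∧ ‖ψ‖ - t * (ε / 2) < ψ w := by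
    obtain ⟨w, hw, hψw⟩ := ψ.exists_lt_apply_of_lt_opNorm
      (show ‖ψ‖ - t * (ε / 2) < ‖ψ‖ from sub_lt_self _ (by positivity))
    rcases abs_choice (ψ w) with h | h
    · exact ⟨w, hw.le, by rwa [Real.norm_eq_abs, h] at hψw⟩
    · exact ⟨-w, by rw [norm_neg]; exact hw.le, by rwa [Real.norm_eq_abs, h, ← map_neg] at hψw⟩
  obtain ⟨s, hs⟩ : ∃ s : Finset ι, ‖ψ‖ - t * (ε / 2) < ψ (∑ i ∈ s, lp.single p i (w i)) :=
    (((ψ.continuous.tendsto w).comp (lp.hasSum_single hp_top w)).eventually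
      (lt_mem_nhds hψw)).exists
  have hle : ∀ v : lp E p, (∀ i ∈ s, v i = 0) → ‖v‖ ≤ C → ψ v ≤ ε := by
    intro v hv hvC
    have hC : 0 ≤ C := (norm_nonneg v).trans hvC
    have hsum : ∑ i ∈ s, ‖w i‖ ^ q ≤ 1 :=
      (lp.sum_rpow_le_norm_rpow hq w s).trans (Real.rpow_le_one (norm_nonneg _) hw hq.le)
    have hnorm : ‖∑ i ∈ s, lp.single p i (w i) + t • v‖ ≤ 1 + t ^ q * C ^ q := by
      have hpow : ‖∑ i ∈ s, lp.single p i (w i) + t • v‖ ^ q ≤ 1 + t ^ q * C ^ q := by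
        rw [lp.norm_sum_single_add_rpow hq w (t • v) s fun i hi => by
          rw [lp.coeFn_smul, Pi.smul_apply, hv i hi, smul_zero]]
        rw [norm_smul, Real.norm_of_nonneg ht.le, Real.mul_rpow ht.le (norm_nonneg _)]
        gcongr
      by_contra! hlt
      have hone : 1 ≤ ‖∑ i ∈ s, lp.single p i (w i) + t • v‖ :=
        (le_add_of_nonneg_right (by positivity)).trans hlt.le
      exact (hlt.trans_le (Real.self_le_rpow_of_one_le hone hp.le)).not_ge hpow
    have hψ := (le_abs_self _).trans (ψ.le_opNorm_of_le hnorm)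
    rw [map_add, map_smul, smul_eq_mul, show t ^ q = t * t ^ (q - 1) by
      rw [Real.rpow_sub_one ht.ne']; field_simp] at hψ
    have hmul := mul_lt_mul_of_pos_left htε ht
    refine le_of_mul_le_mul_left ?_ ht
    linarith
  refine ⟨s, fun v hv hvC => abs_le'.2 ⟨hle v hv hvC, ?_⟩⟩
  rw [← map_neg]
  exact hle (-v) (fun i hi => by rw [lp.coeFn_neg, Pi.neg_apply, hv i hi, neg_zero])
    (by rwa [norm_neg])

/-- For `1 < p < ∞`, a bounded sequence in `lp E p` which is coordinatewise norm null is weakly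
null. -/
theorem lp.tendsto_apply_zero_of_tendsto_coord (hp : 1 < p.toReal) (ψ : lp E p →L[ℝ] ℝ)
    {u : ℕ → lp E p} {C : ℝ} (hu : ∀ n, ‖u n‖ ≤ C)
    (hcoord : ∀ i, Tendsto (fun n => u n i) atTop (nhds 0)) :
    Tendsto (fun n => ψ (u n)) atTop (nhds 0) := by
  have hq : 0 < p.toReal := zero_lt_one.trans hp
  rw [Metric.tendsto_nhds]
  intro ε hε
  obtain ⟨s, hs⟩ := lp.exists_finset_abs_apply_le hp ψ C (half_pos hε)
  have hhead : Tendsto (fun n => ψ (∑ i ∈ s, lp.single p i (u n i))) atTop (nhds 0) := by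
    have h : Tendsto (fun n => ∑ i ∈ s, ψ (lp.single p i (u n i))) atTop (nhds 0) := by
      rw [← Finset.sum_const_zero (s := s)]
      refine tendsto_finsetSum _ fun i _ => ?_
      have hi := ((ψ.comp (lp.singleContinuousLinearMap ℝ E p i)).continuous.tendsto 0).comp
        (hcoord i)
      rwa [map_zero] at hi
    simpa only [map_sum] using h
  filter_upwards [Metric.tendsto_nhds.1 hhead _ (half_pos hε)] with n hn
  have htail : |ψ (u n - ∑ i ∈ s, lp.single p i (u n i))| ≤ ε / 2 := by
    refine hs _ (fun i hi => ?_) ?_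
    · simp only [lp.coeFn_sub, lp.coeFn_sum, lp.coeFn_single, Pi.sub_apply, Finset.sum_apply,
        Finset.sum_pi_single, if_pos hi, sub_self]
    · refine le_trans ?_ (hu n)
      rw [← Real.rpow_le_rpow_iff (norm_nonneg _) (norm_nonneg _) hq,
        lp.norm_compl_sum_single hq]
      exact sub_le_self _ (by positivity)
  rw [Real.dist_0_eq_abs] at hn ⊢
  rw [map_sub] at htail
  have := abs_sub_abs_le_abs_sub (ψ (u n)) (ψ (∑ i ∈ s, lp.single p i (u n i)))
  linarith

end lp

/-- Lemma 4.1 instantiated at the unit vector basis of `ℓ_q`: if each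
coordinate map `f_n : X → Y_n` is continuous and factors through a finite-rank bounded
linear operator, and the combined map `F : X → (⊕_n Y_n)_{ℓ_q}` is well defined and
coarse, then `F` is weakly sequentially continuous. -/
theorem stmt13 {X : Type*} [NormedAddCommGroup X] [NormedSpace ℝ X] [CompleteSpace X]
    (q : ℝ) (hq : 1 < q) [Fact (1 ≤ ENNReal.ofReal q)]
    (Y : ℕ → Type*) [∀ n, NormedAddCommGroup (Y n)] [∀ n, NormedSpace ℝ (Y n)]
    [∀ n, CompleteSpace (Y n)]
    (fN : ∀ n : ℕ, X → Y n)
    (hcont : ∀ n, Continuous (fN n))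
    (hP : ∀ n : ℕ, ∃ P : X →L[ℝ] X,
      FiniteDimensional ℝ (LinearMap.range (P : X →ₗ[ℝ] X)) ∧ ∀ x : X, fN n x = fN n (P x))
    (F : X → lp (fun n => Y n) (ENNReal.ofReal q))
    (hF : ∀ (x : X) (n : ℕ), (F x : ∀ n, Y n) n = fN n x)
    (hcoarse : Coarse F) :
    WeakSeqCont F := by
  intro x x₀ hx ψ
  obtain ⟨t, ht, hxt⟩ := exists_norm_sub_le_of_weak_tendsto hx
  obtain ⟨C, hC⟩ := hcoarse t ht
  have hp : 1 < (ENNReal.ofReal q).toReal := by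
    rwa [ENNReal.toReal_ofReal (zero_le_one.trans hq.le)]
  have hnull := lp.tendsto_apply_zero_of_tendsto_coord hp ψ (u := fun n => F (x n) - F x₀)
    (fun n => hC _ _ (hxt n)) fun k => by
      obtain ⟨P, hfin, hfP⟩ := hP k
      have h := ((hcont k).tendsto _).comp
        (tendsto_apply_of_weak_tendsto_of_finiteDimensional_range hx P)
      simp only [Function.comp_def, ← hfP] at h
      simpa only [lp.coeFn_sub, Pi.sub_apply, hF] using tendsto_sub_nhds_zero_iff.2 h
  simp only [map_sub] at hnull
  exact tendsto_sub_nhds_zero_iff.1 hnull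
end

section
/- Let 1 ≤ p < q < ∞. There exist a map f : ℓ_p → ℓ_q and constants A, B > 0 such that A·‖x − y‖^{p/q} ≤ ‖f(x) − f(y)‖ ≤ B·‖x − y‖^{p/q} for all x, y ∈ ℓ_p, f is weakly sequentially continuous, the restriction of f to every bounded subset of ℓ_p is continuous from the weak topology of ℓ_p to the weak topology of ℓ_q, and yet f is not continuous as a map from ℓ_p with its weak topology to ℓ_q with its weak topology. -/
open Filter

/-- The weak topology on a normed space: the coarsest topology making all continuous
linear functionals continuous. -/
noncomputable def weakTop (X : Type*) [NormedAddCommGroup X] [NormedSpace ℝ X] :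
    TopologicalSpace X :=
  TopologicalSpace.induced (fun x : X => (fun φ : X →L[ℝ] ℝ => φ x)) Pi.topologicalSpace


/-- The values of a bounded functional on the unit vectors of `ℓ_q` form an element of the
conjugate sequence space. -/
theorem summable_rpow_abs_apply_single {q r : ℝ} (hqr : q.HolderConjugate r)
    [Fact (1 ≤ ENNReal.ofReal q)] (ψ : lp (fun _ : ℕ => ℝ) (ENNReal.ofReal q) →L[ℝ] ℝ) :
    Summable fun i => |ψ (lp.single _ i 1)| ^ r := by
  have hq := hqr.pos
  have hr := hqr.symm.pos
  set b : ℕ → ℝ := fun i => ψ (lp.single _ i 1) with hb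
  refine summable_of_sum_le (c := ‖ψ‖ ^ r) (fun i => by positivity) fun G => ?_
  set S := ∑ i ∈ G, |b i| ^ r with hS
  have hS0 : 0 ≤ S := Finset.sum_nonneg fun i _ => by positivity
  let c : ℕ → ℝ := fun i => SignType.sign (b i) * |b i| ^ (r - 1)
  have hcb (i : ℕ) : c i * b i = |b i| ^ r := by
    rcases eq_or_ne (b i) 0 with h | h
    · simp [c, h, Real.zero_rpow hr.ne']
    · have : |b i| ^ r = |b i| ^ (r - 1) * |b i| := by
        rw [← Real.rpow_add_one (abs_pos.2 h).ne']; ring_nf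
      simp only [c]
      rw [this, mul_right_comm, sign_mul_self, mul_comm]
  have hcn (i : ℕ) : |c i| ^ q = |b i| ^ r := by
    rcases eq_or_ne (b i) 0 with h | h
    · simp [c, h, Real.zero_rpow hr.ne', Real.zero_rpow hq.ne']
    · have : |c i| = |b i| ^ (r - 1) := by
        rcases h.lt_or_gt with h | h
        · simp [c, sign_neg h, abs_of_nonneg (Real.rpow_nonneg (abs_nonneg (b i)) _)]
        · simp [c, sign_pos h, abs_of_nonneg (Real.rpow_nonneg (abs_nonneg (b i)) _)]
      rw [this, ← Real.rpow_mul (abs_nonneg _)]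
      congr 1
      have := hqr.mul_eq_add
      linarith
  let y : lp (fun _ : ℕ => ℝ) (ENNReal.ofReal q) := ∑ i ∈ G, lp.single _ i (c i)
  have hy : ‖y‖ ^ q = S := by
    have := lp.norm_sum_single (E := fun _ : ℕ => ℝ) (p := ENNReal.ofReal q)
      (by rw [ENNReal.toReal_ofReal hq.le]; exact hq) c G
    simpa [ENNReal.toReal_ofReal hq.le, hcn] using this
  have hψy : ψ y = S := by
    have hs (i : ℕ) : lp.single (E := fun _ : ℕ => ℝ) (ENNReal.ofReal q) i (c i)
        = c i • lp.single (ENNReal.ofReal q) i (1 : ℝ) := by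
      rw [← lp.single_smul]; simp
    simp only [y, map_sum, hs, map_smul, smul_eq_mul]
    exact Finset.sum_congr rfl fun i _ => hcb i
  have hle : S ≤ ‖ψ‖ * ‖y‖ := by
    have := ψ.le_opNorm y
    rw [hψy] at this
    exact (le_abs_self _).trans this
  have hyn : ‖y‖ = S ^ (1 / q) := by
    rw [← hy, one_div, Real.rpow_rpow_inv (norm_nonneg _) hq.ne']
  rcases hS0.eq_or_lt with h | h
  · rw [← h]; positivity
  have h1 : S ^ (1 / r) ≤ ‖ψ‖ := by
    have h2 : S = S ^ (1 / r) * S ^ (1 / q) := by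
      rw [← Real.rpow_add h, one_div, one_div, add_comm, hqr.inv_add_inv_eq_one, Real.rpow_one]
    rw [hyn] at hle
    have h3 : 0 < S ^ (1 / q) := Real.rpow_pos_of_pos h _
    refine le_of_mul_le_mul_right ?_ h3
    rwa [← h2]
  calc S = (S ^ (1 / r)) ^ r := by rw [one_div, Real.rpow_inv_rpow hS0 hr.ne']
    _ ≤ ‖ψ‖ ^ r := Real.rpow_le_rpow (by positivity) h1 hr.le

/-- On `ℓ_q` with `1 < q < ∞`, a functional is uniformly small on bounded sequences that vanish
on a large finite set. -/
theorem exists_finset_abs_apply_le {q : ℝ} (hq : 1 < q) [Fact (1 ≤ ENNReal.ofReal q)]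
    (ψ : lp (fun _ : ℕ => ℝ) (ENNReal.ofReal q) →L[ℝ] ℝ) {ε : ℝ} (hε : 0 < ε) :
    ∃ F : Finset ℕ, ∀ z : lp (fun _ : ℕ => ℝ) (ENNReal.ofReal q),
      |ψ z - ∑ i ∈ F, z i * ψ (lp.single _ i 1)| ≤ ε * ‖z‖ := by
  have hq0 : 0 < q := by linarith
  set r := q.conjExponent
  have hqr : q.HolderConjugate r := Real.HolderConjugate.conjExponent hq
  have hr := hqr.symm.pos
  have hsum := summable_rpow_abs_apply_single hqr ψ
  set b : ℕ → ℝ := fun i => ψ (lp.single _ i 1) with hb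
  obtain ⟨F, hF⟩ := summable_iff_vanishing_norm.1 hsum (ε ^ r) (by positivity)
  refine ⟨F, fun z => ?_⟩
  have hz : HasSum (fun i => z i * b i) (ψ z) := by
    have h := (lp.hasSum_single (E := fun _ : ℕ => ℝ) ENNReal.ofReal_ne_top z).mapL ψ
    convert h using 2 with i
    have : lp.single (E := fun _ : ℕ => ℝ) (ENNReal.ofReal q) i (z i)
        = z i • lp.single (ENNReal.ofReal q) i (1 : ℝ) := by
      rw [← lp.single_smul]; simp
    rw [this, map_smul, smul_eq_mul]
  have hlim : Tendsto (fun G : Finset ℕ => |∑ i ∈ G, z i * b i - ∑ i ∈ F, z i * b i|) atTop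
      (nhds |ψ z - ∑ i ∈ F, z i * b i|) := (hz.sub_const _).abs
  refine le_of_tendsto hlim ?_
  filter_upwards [eventually_ge_atTop F] with G hG
  rw [← Finset.sum_sdiff (show F ⊆ G from hG), add_sub_cancel_right]
  calc |∑ i ∈ G \ F, z i * b i| ≤ ∑ i ∈ G \ F, |z i| * |b i| := by
        simpa [abs_mul] using Finset.abs_sum_le_sum_abs (fun i => z i * b i) (G \ F)
    _ ≤ (∑ i ∈ G \ F, |z i| ^ q) ^ (1 / q) * (∑ i ∈ G \ F, |b i| ^ r) ^ (1 / r) := by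
        simpa using Real.inner_le_Lp_mul_Lq (G \ F) (fun i => |z i|) (fun i => |b i|) hqr
    _ ≤ ‖z‖ * ε := by
        gcongr
        · have := lp.sum_rpow_le_norm_rpow (E := fun _ : ℕ => ℝ) (p := ENNReal.ofReal q)
            (by rwa [ENNReal.toReal_ofReal hq0.le]) z (G \ F)
          rw [ENNReal.toReal_ofReal hq0.le] at this
          calc _ ≤ (‖z‖ ^ q) ^ (1 / q) := by
                gcongr
                simpa using this
            _ = ‖z‖ := by rw [one_div, Real.rpow_rpow_inv (norm_nonneg _) hq0.ne']
        · have := (hF (G \ F) Finset.sdiff_disjoint).le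
          rw [Real.norm_of_nonneg (Finset.sum_nonneg fun i _ => by positivity)] at this
          calc _ ≤ (ε ^ r) ^ (1 / r) := by gcongr
            _ = ε := by rw [one_div, Real.rpow_rpow_inv hε.le hr.ne']
    _ = ε * ‖z‖ := mul_comm _ _

/-- In `ℓ_q` with `1 < q < ∞`, bounded coordinatewise convergence implies weak convergence. -/
theorem tendsto_apply_of_bounded_of_tendsto_coord {q : ℝ} (hq : 1 < q)
    [Fact (1 ≤ ENNReal.ofReal q)] {α : Type*} {l : Filter α}
    {y : α → lp (fun _ : ℕ => ℝ) (ENNReal.ofReal q)} {y₀ : lp (fun _ : ℕ => ℝ) (ENNReal.ofReal q)}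
    {R : ℝ} (hR : ∀ᶠ a in l, ‖y a - y₀‖ ≤ R)
    (hy : ∀ i, Tendsto (fun a => y a i) l (nhds (y₀ i)))
    (ψ : lp (fun _ : ℕ => ℝ) (ENNReal.ofReal q) →L[ℝ] ℝ) :
    Tendsto (fun a => ψ (y a)) l (nhds (ψ y₀)) := by
  rw [Metric.tendsto_nhds]
  intro ε hε
  have hR' : 0 < |R| + 1 := by positivity
  obtain ⟨F, hF⟩ := exists_finset_abs_apply_le hq ψ (ε := ε / (2 * (|R| + 1))) (by positivity)
  have hfin : Tendsto (fun a => ∑ i ∈ F, (y a - y₀) i * ψ (lp.single _ i 1)) l (nhds 0) := by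
    rw [show (0 : ℝ) = ∑ i ∈ F, (y₀ i - y₀ i) * ψ (lp.single _ i 1) by simp]
    exact tendsto_finsetSum _ fun i _ => ((hy i).sub_const _).mul_const _
  filter_upwards [hR, (Metric.tendsto_nhds.1 hfin) (ε / 2) (by positivity)] with a ha hfa
  have h1 := hF (y a - y₀)
  rw [Real.dist_eq, sub_zero] at hfa
  rw [Real.dist_eq, ← map_sub]
  have h2 : ε / (2 * (|R| + 1)) * ‖y a - y₀‖ ≤ ε / 2 := by
    calc _ ≤ ε / (2 * (|R| + 1)) * (|R| + 1) := by
          gcongr; linarith [le_abs_self R]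
      _ = ε / 2 := by field_simp
  have h3 := abs_sub_abs_le_abs_sub (ψ (y a - y₀))
    (∑ i ∈ F, (y a - y₀) i * ψ (lp.single _ i 1))
  linarith

/-- The weighted sum of the oscillations of a bounded Lipschitz function at all dyadic scales is
controlled by a power of the distance. -/
theorem exists_tsum_dyadic_le {p q : ℝ} (hp : 0 < p) (hpq : p < q) :
    ∃ C : ℝ, 0 < C ∧ ∀ (u : ℝ → ℝ), (∀ a b, |u a - u b| ≤ 2) → (∀ a b, |u a - u b| ≤ |a - b|) →
      ∀ a b : ℝ, Summable (fun j : ℤ =>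
          ((2 : ℝ) ^ j) ^ (-p) * |u ((2 : ℝ) ^ j * a) - u ((2 : ℝ) ^ j * b)| ^ q) ∧
        ∑' j : ℤ, ((2 : ℝ) ^ j) ^ (-p) * |u ((2 : ℝ) ^ j * a) - u ((2 : ℝ) ^ j * b)| ^ q
          ≤ C * |a - b| ^ p := by
  have hq : 0 < q := hp.trans hpq
  let M : ℤ → ℝ := fun k => ((2 : ℝ) ^ k) ^ (-p) * (min 2 ((2 : ℝ) ^ k)) ^ q
  have hM0 (k : ℤ) : 0 ≤ M k := by positivity
  have hM : Summable M := by
    refine Summable.of_nat_of_neg ?_ ?_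
    · have hg : Summable fun n : ℕ => (2 : ℝ) ^ q * ((2 : ℝ) ^ (-p)) ^ n :=
        (summable_geometric_of_lt_one (by positivity)
          (Real.rpow_lt_one_of_one_lt_of_neg one_lt_two (by linarith))).mul_left _
      refine Summable.of_nonneg_of_le (fun n => hM0 _) (fun n => ?_) hg
      simp only [M, zpow_natCast]
      rw [mul_comm, ← Real.rpow_natCast, ← Real.rpow_mul two_pos.le, ← Real.rpow_natCast,
        ← Real.rpow_mul two_pos.le, mul_comm (n : ℝ)]
      gcongr
      exact min_le_left _ _
    · have hg : Summable fun n : ℕ => ((2 : ℝ) ^ (p - q)) ^ n :=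
        summable_geometric_of_lt_one (by positivity)
          (Real.rpow_lt_one_of_one_lt_of_neg one_lt_two (by linarith))
      refine Summable.of_nonneg_of_le (fun n => hM0 _) (fun n => ?_) hg
      have h2 : (2 : ℝ) ^ (-(n : ℤ)) = 2 ^ (-(n : ℝ)) := by
        rw [zpow_neg, zpow_natCast, Real.rpow_neg two_pos.le, Real.rpow_natCast]
      have : ((2 : ℝ) ^ (p - q)) ^ n = ((2 : ℝ) ^ (-(n : ℤ))) ^ (-p) * ((2 : ℝ) ^ (-(n : ℤ))) ^ q := by
        rw [h2, ← Real.rpow_mul two_pos.le, ← Real.rpow_mul two_pos.le, ← Real.rpow_add two_pos,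
          ← Real.rpow_natCast, ← Real.rpow_mul two_pos.le]
        ring_nf
      simp only [M]
      rw [this]
      gcongr
      exact min_le_right _ _
  refine ⟨2 ^ p * (∑' k, M k + 1), by have : 0 ≤ ∑' k, M k := tsum_nonneg hM0; positivity,
    fun u hu2 hul a b => ?_⟩
  rcases eq_or_ne a b with rfl | hab
  · simp [Real.zero_rpow hq.ne', Real.zero_rpow hp.ne', summable_zero]
  have hd : 0 < |a - b| := abs_pos.2 (sub_ne_zero.2 hab)
  set d := |a - b|
  obtain ⟨m, hm1, hm2⟩ := exists_mem_Ico_zpow (inv_pos.2 hd) (one_lt_two (α := ℝ))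
  have hm0 : (0 : ℝ) < 2 ^ m := by positivity
  let T : ℤ → ℝ := fun j => ((2 : ℝ) ^ j) ^ (-p) * |u ((2 : ℝ) ^ j * a) - u ((2 : ℝ) ^ j * b)| ^ q
  have hT (k : ℤ) : T (k + m) ≤ 2 ^ p * d ^ p * M k := by
    have hk : (0 : ℝ) < 2 ^ k := by positivity
    have hmd : (2 : ℝ) ^ m * d ≤ 1 := by
      calc _ ≤ d⁻¹ * d := by gcongr
        _ = 1 := inv_mul_cancel₀ hd.ne'
    have h1 : ((2 : ℝ) ^ m) ^ (-p) ≤ 2 ^ p * d ^ p := by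
      rw [Real.rpow_neg hm0.le, ← Real.inv_rpow hm0.le, ← Real.mul_rpow two_pos.le hd.le]
      gcongr
      rw [zpow_add_one₀ two_ne_zero] at hm2
      rw [inv_le_comm₀ hm0 (by positivity), mul_inv]
      linarith
    have h2 : |u ((2 : ℝ) ^ (k + m) * a) - u ((2 : ℝ) ^ (k + m) * b)| ≤ min 2 (2 ^ k) := by
      refine le_min (hu2 _ _) ((hul _ _).trans ?_)
      rw [← mul_sub, abs_mul, abs_of_pos (by positivity), zpow_add₀ two_ne_zero, mul_assoc]
      exact mul_le_of_le_one_right hk.le hmd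
    calc T (k + m) = ((2 : ℝ) ^ m) ^ (-p) * (((2 : ℝ) ^ k) ^ (-p) *
          |u ((2 : ℝ) ^ (k + m) * a) - u ((2 : ℝ) ^ (k + m) * b)| ^ q) := by
          simp only [T]
          rw [zpow_add₀ two_ne_zero k m, Real.mul_rpow hk.le hm0.le]; ring
      _ ≤ 2 ^ p * d ^ p * M k := by
          simp only [M]
          gcongr
  have hTs : Summable fun k => T (k + m) :=
    Summable.of_nonneg_of_le (fun k => by positivity) hT (hM.mul_left _)
  refine ⟨(Equiv.addRight m).summable_iff.1 hTs, ?_⟩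
  calc ∑' j, T j = ∑' k, T (k + m) := ((Equiv.addRight m).tsum_eq T).symm
    _ ≤ ∑' k, 2 ^ p * d ^ p * M k := hTs.tsum_le_tsum hT (hM.mul_left _)
    _ = 2 ^ p * (∑' k, M k) * d ^ p := by rw [tsum_mul_left]; ring
    _ ≤ 2 ^ p * (∑' k, M k + 1) * d ^ p := by gcongr; linarith

/-- At distance between `1` and `2`, cosine and sine cannot both be nearly equal. -/
theorem half_le_abs_cos_sub_or_abs_sin_sub {a b : ℝ} (h1 : 1 ≤ |a - b|) (h2 : |a - b| ≤ 2) :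
    1 / 2 ≤ |Real.cos a - Real.cos b| ∨ 1 / 2 ≤ |Real.sin a - Real.sin b| := by
  by_contra! h
  have hc : Real.cos (a - b) ≤ 5 / 9 := by
    rw [← Real.cos_abs]
    exact (Real.cos_le_cos_of_nonneg_of_le_pi zero_le_one
      (h2.trans Real.two_le_pi) h1).trans Real.cos_one_le
  rw [Real.cos_sub] at hc
  have e1 := sq_lt_sq' (neg_lt_of_abs_lt h.1) (lt_of_abs_lt h.1)
  have e2 := sq_lt_sq' (neg_lt_of_abs_lt h.2) (lt_of_abs_lt h.2)
  nlinarith [Real.sin_sq_add_cos_sq a, Real.sin_sq_add_cos_sq b]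

/-- The map `t ↦ |t| ^ s` is `s`-Hölder for `0 ≤ s ≤ 1`. -/
theorem abs_rpow_abs_sub_rpow_abs_le {s : ℝ} (h0 : 0 ≤ s) (h1 : s ≤ 1) (a b : ℝ) :
    |(|a| ^ s - |b| ^ s)| ≤ |a - b| ^ s := by
  have key (x y : ℝ) : |x| ^ s ≤ |x - y| ^ s + |y| ^ s := by
    calc |x| ^ s ≤ (|x - y| + |y|) ^ s := by
          gcongr
          simpa using abs_add_le (x - y) y
      _ ≤ _ := Real.rpow_add_le_add_rpow (abs_nonneg _) (abs_nonneg _) h0 h1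
  rw [abs_le]
  have e1 := key a b
  have e2 := key b a
  rw [abs_sub_comm b a] at e2
  constructor <;> linarith

/-- A bi-Hölder embedding of the line into an `ℓ_q` space, with exponent `p / q` and with
`|t| ^ (p / q)` among its coordinates. -/
theorem exists_snowflake_coordinates {p q : ℝ} (hp : 0 < p) (hpq : p < q) :
    ∃ (h : Fin 3 × ℤ → ℝ → ℝ) (A B : ℝ), 0 < A ∧ 0 < B ∧ (∀ i, Continuous (h i)) ∧
      (∀ i, h i 0 = 0) ∧ (∀ t, h (2, 0) t = |t| ^ (p / q)) ∧
      ∀ a b, Summable (fun i => |h i a - h i b| ^ q) ∧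
        A * |a - b| ^ p ≤ ∑' i, |h i a - h i b| ^ q ∧
        ∑' i, |h i a - h i b| ^ q ≤ B * |a - b| ^ p := by
  have hq : 0 < q := hp.trans hpq
  have hs : 0 < p / q := div_pos hp hq
  have hs1 : p / q ≤ 1 := (div_le_one hq).2 hpq.le
  obtain ⟨C, hC, hu⟩ := exists_tsum_dyadic_le hp hpq
  let w : (ℝ → ℝ) → ℤ → ℝ → ℝ :=
    fun u j t => ((2 : ℝ) ^ j) ^ (-(p / q)) * (u ((2 : ℝ) ^ j * t) - u 0)
  have hw (u : ℝ → ℝ) (j : ℤ) (a b : ℝ) : |w u j a - w u j b| ^ q =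
      ((2 : ℝ) ^ j) ^ (-p) * |u ((2 : ℝ) ^ j * a) - u ((2 : ℝ) ^ j * b)| ^ q := by
    have h2 : (0 : ℝ) < 2 ^ j := by positivity
    simp only [w]
    rw [← mul_sub, sub_sub_sub_cancel_right, abs_mul, abs_of_pos (by positivity),
      Real.mul_rpow (by positivity) (abs_nonneg _), ← Real.rpow_mul h2.le]
    congr 2
    field_simp
  let g : ℤ → ℝ → ℝ := fun j t => if j = 0 then |t| ^ (p / q) else 0
  have hg (a b : ℝ) (j : ℤ) : |g j a - g j b| ^ q =
      if j = 0 then |(|a| ^ (p / q) - |b| ^ (p / q))| ^ q else 0 := by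
    by_cases hj : j = 0 <;> simp [g, hj, Real.zero_rpow hq.ne']
  have hcos := hu Real.cos (fun a b => abs_le.2
    ⟨by linarith [Real.neg_one_le_cos a, Real.cos_le_one b],
      by linarith [Real.neg_one_le_cos b, Real.cos_le_one a]⟩) Real.abs_cos_sub_cos_le
  have hsin := hu Real.sin (fun a b => abs_le.2
    ⟨by linarith [Real.neg_one_le_sin a, Real.sin_le_one b],
      by linarith [Real.neg_one_le_sin b, Real.sin_le_one a]⟩) Real.abs_sin_sub_sin_le
  let h : Fin 3 × ℤ → ℝ → ℝ := fun i => ![w Real.cos i.2, w Real.sin i.2, g i.2] i.1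
  have hsum (a b : ℝ) : Summable fun i => |h i a - h i b| ^ q := by
    refine (summable_prod_of_nonneg fun i => by positivity).2 ⟨fun i => ?_, .of_finite⟩
    fin_cases i
    · simpa [h, hw] using (hcos a b).1
    · simpa [h, hw] using (hsin a b).1
    · simpa [h, hg] using (hasSum_ite_eq (0 : ℤ) (|(|a| ^ (p / q) - |b| ^ (p / q))| ^ q)).summable
  have hval (a b : ℝ) : ∑' i, |h i a - h i b| ^ q =
      ∑' j : ℤ, ((2 : ℝ) ^ j) ^ (-p) *
        |Real.cos ((2 : ℝ) ^ j * a) - Real.cos ((2 : ℝ) ^ j * b)| ^ q +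
      ∑' j : ℤ, ((2 : ℝ) ^ j) ^ (-p) *
        |Real.sin ((2 : ℝ) ^ j * a) - Real.sin ((2 : ℝ) ^ j * b)| ^ q +
      |(|a| ^ (p / q) - |b| ^ (p / q))| ^ q := by
    rw [(hsum a b).tsum_prod, tsum_fintype, Fin.sum_univ_three]
    simp [h, hw, hg]
  refine ⟨h, (1 / 2) ^ p * (1 / 2) ^ q, C + C + 1, by positivity, by positivity, ?_, ?_, ?_,
    fun a b => ⟨hsum a b, ?_, ?_⟩⟩
  · rintro ⟨i, j⟩
    fin_cases i
    · simp only [h, w]; dsimp; fun_prop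
    · simp only [h, w]; dsimp; fun_prop
    · by_cases hj : j = 0
      · simpa [h, g, hj] using continuous_abs.rpow_const fun _ => Or.inr hs.le
      · simpa [h, g, hj] using continuous_const
  · rintro ⟨i, j⟩
    fin_cases i <;> simp [h, w, g, Real.zero_rpow hs.ne']
  · intro t
    simp [h, g]
  · rw [hval]
    rcases eq_or_ne a b with rfl | hab
    · simp [Real.zero_rpow hq.ne', Real.zero_rpow hp.ne']
    have hd : 0 < |a - b| := abs_pos.2 (sub_ne_zero.2 hab)
    obtain ⟨m, hm1, hm2⟩ := exists_mem_Ico_zpow (inv_pos.2 hd) (one_lt_two (α := ℝ))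
    set j := m + 1
    have hj0 : (0 : ℝ) < 2 ^ j := by positivity
    have hjd : |(2 : ℝ) ^ j * a - 2 ^ j * b| = 2 ^ j * |a - b| := by
      rw [← mul_sub, abs_mul, abs_of_pos hj0]
    have h1 : 1 ≤ (2 : ℝ) ^ j * |a - b| := by
      rw [← inv_mul_cancel₀ hd.ne']; gcongr
    have h2 : (2 : ℝ) ^ j * |a - b| ≤ 2 := by
      calc (2 : ℝ) ^ j * |a - b| = 2 * 2 ^ m * |a - b| := by
            rw [show j = m + 1 from rfl, zpow_add_one₀ two_ne_zero]; ring
        _ ≤ 2 * |a - b|⁻¹ * |a - b| := by gcongr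
        _ = 2 := by rw [mul_assoc, inv_mul_cancel₀ hd.ne', mul_one]
    have hterm {x : ℝ} (hx : 1 / 2 ≤ x) :
        (1 / 2) ^ p * (1 / 2) ^ q * |a - b| ^ p ≤ ((2 : ℝ) ^ j) ^ (-p) * x ^ q := by
      have : (1 / 2 * |a - b|) ^ p ≤ ((2 : ℝ) ^ j) ^ (-p) := by
        rw [Real.rpow_neg hj0.le, ← Real.inv_rpow hj0.le]
        gcongr
        rw [le_inv_comm₀ (by positivity) hj0, mul_inv, ← div_eq_mul_inv, le_div_iff₀ hd]
        simpa using h2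
      calc _ = (1 / 2 * |a - b|) ^ p * (1 / 2) ^ q := by
            rw [Real.mul_rpow (by norm_num) hd.le]; ring
        _ ≤ _ := by gcongr
    have hc0 : 0 ≤ ∑' j : ℤ, ((2 : ℝ) ^ j) ^ (-p) *
        |Real.cos ((2 : ℝ) ^ j * a) - Real.cos ((2 : ℝ) ^ j * b)| ^ q :=
      tsum_nonneg fun j => by positivity
    have hs0 : 0 ≤ ∑' j : ℤ, ((2 : ℝ) ^ j) ^ (-p) *
        |Real.sin ((2 : ℝ) ^ j * a) - Real.sin ((2 : ℝ) ^ j * b)| ^ q :=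
      tsum_nonneg fun j => by positivity
    have hg0 : 0 ≤ |(|a| ^ (p / q) - |b| ^ (p / q))| ^ q := by positivity
    rw [← hjd] at h1 h2
    rcases half_le_abs_cos_sub_or_abs_sin_sub h1 h2 with hx | hx
    · have := (hcos a b).1.le_tsum j fun i _ => by positivity
      linarith [hterm hx]
    · have := (hsin a b).1.le_tsum j fun i _ => by positivity
      linarith [hterm hx]
  · rw [hval]
    have : |(|a| ^ (p / q) - |b| ^ (p / q))| ^ q ≤ |a - b| ^ p := by
      calc _ ≤ (|a - b| ^ (p / q)) ^ q := by
            gcongr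
            exact abs_rpow_abs_sub_rpow_abs_le hs.le hs1 a b
        _ = |a - b| ^ p := by rw [← Real.rpow_mul (abs_nonneg _), div_mul_cancel₀ _ hq.ne']
    linarith [(hcos a b).2, (hsin a b).2]

/-- Applying a bi-Hölder family of coordinates to every entry of points of `ℓ_p` gives points of
`ℓ_q` with comparable distances. -/
theorem summable_and_tsum_bounds_of_coordinates {ι : Type*} {p q A B : ℝ} (hp : 0 < p)
    {h : ι → ℝ → ℝ}
    (hs : ∀ a b, Summable (fun i => |h i a - h i b| ^ q) ∧
        A * |a - b| ^ p ≤ ∑' i, |h i a - h i b| ^ q ∧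
        ∑' i, |h i a - h i b| ^ q ≤ B * |a - b| ^ p)
    (e : ℕ ≃ ℕ × ι) (x y : lp (fun _ : ℕ => ℝ) (ENNReal.ofReal p)) :
    Summable (fun m => |h (e m).2 (x (e m).1) - h (e m).2 (y (e m).1)| ^ q) ∧
      A * ‖x - y‖ ^ p ≤ ∑' m, |h (e m).2 (x (e m).1) - h (e m).2 (y (e m).1)| ^ q ∧
      ∑' m, |h (e m).2 (x (e m).1) - h (e m).2 (y (e m).1)| ^ q ≤ B * ‖x - y‖ ^ p := by
  have hxy : HasSum (fun n => |x n - y n| ^ p) (‖x - y‖ ^ p) := by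
    have := lp.hasSum_norm (p := ENNReal.ofReal p)
      (by rwa [ENNReal.toReal_ofReal hp.le]) (x - y)
    simpa [ENNReal.toReal_ofReal hp.le] using this
  let T : ℕ × ι → ℝ := fun k => |h k.2 (x k.1) - h k.2 (y k.1)| ^ q
  have hrow : Summable fun n => ∑' i, T (n, i) :=
    Summable.of_nonneg_of_le (fun n => tsum_nonneg fun i => by positivity)
      (fun n => (hs (x n) (y n)).2.2) (hxy.summable.mul_left B)
  have hT : Summable T :=
    (summable_prod_of_nonneg fun k => by positivity).2 ⟨fun n => (hs (x n) (y n)).1, hrow⟩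
  have hval : ∑' m, T (e m) = ∑' n, ∑' i, T (n, i) := by
    rw [e.tsum_eq T, hT.tsum_prod]
  refine ⟨e.summable_iff.2 hT, ?_, ?_⟩
  · change _ ≤ ∑' m, T (e m)
    rw [hval, ← (hxy.mul_left A).tsum_eq]
    exact (hxy.mul_left A).summable.tsum_le_tsum (fun n => (hs (x n) (y n)).2.1) hrow
  · change ∑' m, T (e m) ≤ _
    rw [hval, ← (hxy.mul_left B).tsum_eq]
    exact hrow.tsum_le_tsum (fun n => (hs (x n) (y n)).2.2) (hxy.mul_left B).summable

/-- Finitely many functionals on `ℓ_p` have a common nonzero zero. -/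
theorem exists_ne_zero_forall_apply_eq_zero {P : ENNReal} [Fact (1 ≤ P)]
    (I : Finset (lp (fun _ : ℕ => ℝ) P →L[ℝ] ℝ)) :
    ∃ x : lp (fun _ : ℕ => ℝ) P, x ≠ 0 ∧ ∀ φ ∈ I, φ x = 0 := by
  let S : (Fin (I.card + 1) → ℝ) →ₗ[ℝ] lp (fun _ : ℕ => ℝ) P :=
    ∑ i : Fin (I.card + 1), lp.lsingle (𝕜 := ℝ) P (i : ℕ) ∘ₗ LinearMap.proj i
  let L : (Fin (I.card + 1) → ℝ) →ₗ[ℝ] (I → ℝ) :=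
    (LinearMap.pi fun φ : I => (φ : lp (fun _ : ℕ => ℝ) P →L[ℝ] ℝ).toLinearMap) ∘ₗ S
  have hS (a : Fin (I.card + 1) → ℝ) (k : Fin (I.card + 1)) : S a k = a k := by
    simp only [S, LinearMap.sum_apply, LinearMap.comp_apply, LinearMap.proj_apply,
      lp.coeFn_sum, Finset.sum_apply]
    rw [Finset.sum_eq_single k]
    · exact lp.single_apply_self ..
    · exact fun i _ hik => lp.single_apply_ne _ _ _ fun h => hik (Fin.ext h.symm)
    · simp
  obtain ⟨a, ha, ha0⟩ := (LinearMap.ker L).ne_bot_iff.1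
    (LinearMap.ker_ne_bot_of_finrank_lt (f := L) (by simp))
  refine ⟨S a, fun h => ha0 (funext fun k => ?_), fun φ hφ => ?_⟩
  · rw [← hS a k, h]; rfl
  · exact congrFun (LinearMap.mem_ker.1 ha) ⟨φ, hφ⟩

/-- A weakly continuous map sends a whole line through the origin into any prescribed weak
half-space containing the image of the origin. -/
theorem exists_line_apply_lt_of_continuous_weakTop {P Q : ENNReal} [Fact (1 ≤ P)] [Fact (1 ≤ Q)]
    {f : lp (fun _ : ℕ => ℝ) P → lp (fun _ : ℕ => ℝ) Q}
    (hf : @Continuous _ _ (weakTop _) (weakTop _) f)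
    (ψ : lp (fun _ : ℕ => ℝ) Q →L[ℝ] ℝ) {c : ℝ} (h0 : ψ (f 0) < c) :
    ∃ x : lp (fun _ : ℕ => ℝ) P, x ≠ 0 ∧ ∀ t : ℝ, ψ (f (t • x)) < c := by
  have hopen : @IsOpen _ (weakTop (lp (fun _ : ℕ => ℝ) Q)) {y | ψ y < c} :=
    isOpen_induced_iff.2 ⟨{g | g ψ < c}, isOpen_lt (continuous_apply ψ) continuous_const, rfl⟩
  obtain ⟨V, hV, hVf⟩ := isOpen_induced_iff.1
    (@Continuous.isOpen_preimage _ _ (weakTop _) (weakTop _) f hf _ hopen)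
  have hmem : (fun φ : lp (fun _ : ℕ => ℝ) P →L[ℝ] ℝ => φ 0) ∈ V := by
    have : (0 : lp (fun _ : ℕ => ℝ) P) ∈ f ⁻¹' {y | ψ y < c} := h0
    rwa [← hVf] at this
  obtain ⟨I, u, hu, huV⟩ := isOpen_pi_iff.1 hV _ hmem
  obtain ⟨x, hx0, hx⟩ := exists_ne_zero_forall_apply_eq_zero I
  refine ⟨x, hx0, fun t => ?_⟩
  have : t • x ∈ f ⁻¹' {y | ψ y < c} := by
    rw [← hVf]
    refine huV fun φ hφ => ?_
    have h1 := (hu φ hφ).2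
    simpa [hx φ hφ] using h1
  exact this

/-- Weakly convergent sequences are bounded. -/
theorem exists_norm_le_of_forall_tendsto_apply {X : Type*} [NormedAddCommGroup X]
    [NormedSpace ℝ X] {x : ℕ → X} {x₀ : X}
    (h : ∀ φ : X →L[ℝ] ℝ, Tendsto (fun n => φ (x n)) atTop (nhds (φ x₀))) :
    ∃ R, ∀ n, ‖x n‖ ≤ R := by
  obtain ⟨R, hR⟩ := banach_steinhaus (g := fun n => NormedSpace.inclusionInDoubleDual ℝ X (x n))
    fun φ => by
      obtain ⟨C, hC⟩ := (Metric.isBounded_range_of_tendsto _ (h φ)).exists_norm_le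
      exact ⟨C, fun n => hC _ ⟨n, rfl⟩⟩
  exact ⟨R, fun n => by
    simpa using (NormedSpace.inclusionInDoubleDualLi ℝ (E := X)).norm_map (x n) ▸ hR n⟩

/-- Bounded functionals are weakly continuous. -/
theorem continuous_apply_weakTop {X : Type*} [NormedAddCommGroup X] [NormedSpace ℝ X]
    (φ : X →L[ℝ] ℝ) : @Continuous _ _ (weakTop X) _ φ :=
  @Continuous.comp X ((X →L[ℝ] ℝ) → ℝ) ℝ (weakTop X) _ _ (fun x φ => φ x) (fun g => g φ)
    (continuous_apply φ) continuous_induced_dom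

/-- Weak-to-weak continuity is tested functional by functional. -/
theorem continuousOn_weakTop_iff {X Y : Type*} [NormedAddCommGroup X] [NormedSpace ℝ X]
    [NormedAddCommGroup Y] [NormedSpace ℝ Y] {f : X → Y} {s : Set X} :
    @ContinuousOn _ _ (weakTop X) (weakTop Y) f s ↔
      ∀ ψ : Y →L[ℝ] ℝ, @ContinuousOn _ _ (weakTop X) _ (fun x => ψ (f x)) s := by
  have h : @Topology.IsInducing _ _ (weakTop Y) _ fun (y : Y) (ψ : Y →L[ℝ] ℝ) => ψ y :=
    @Topology.IsInducing.mk _ _ (weakTop Y) _ _ rfl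
  exact (@Topology.IsInducing.continuousOn_iff _ _ _ (weakTop X) (weakTop Y) _ _ _ h _).trans
    (@continuousOn_pi X (weakTop X) (Y →L[ℝ] ℝ) (fun _ => ℝ) _ (fun x ψ => ψ (f x)) s)

/-- A functional on `ℓ_q` dominating each of a sequence of coordinates on the positive cone. -/
theorem exists_functional_ge {Q : ENNReal} [Fact (1 ≤ Q)] (k : ℕ → ℕ) :
    ∃ (ψ : lp (fun _ : ℕ => ℝ) Q →L[ℝ] ℝ), ∀ y : lp (fun _ : ℕ => ℝ) Q, (∀ n, 0 ≤ y (k n)) →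
      ∀ n, (1 / 2) ^ n * y (k n) ≤ ψ y := by
  have hQ : Q ≠ 0 := (zero_lt_one.trans_le (Fact.out : 1 ≤ Q)).ne'
  let T : ℕ → lp (fun _ : ℕ => ℝ) Q →L[ℝ] ℝ :=
    fun n => ((1 / 2 : ℝ) ^ n) • lp.evalCLM ℝ (fun _ : ℕ => ℝ) Q (k n)
  have hT : Summable T := by
    refine Summable.of_norm_bounded (summable_geometric_two) fun n => ?_
    refine ContinuousLinearMap.opNorm_le_bound _ (by positivity) fun y => ?_
    change ‖(1 / 2 : ℝ) ^ n * y (k n)‖ ≤ _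
    rw [norm_mul, norm_pow, Real.norm_of_nonneg (by norm_num : (0 : ℝ) ≤ 1 / 2)]
    gcongr
    exact lp.norm_apply_le_norm hQ y _
  refine ⟨∑' n, T n, fun y hy n => ?_⟩
  have := hT.hasSum.mapL (ContinuousLinearMap.apply ℝ ℝ y)
  exact le_hasSum this n fun m _ => mul_nonneg (by positivity) (hy m)

/-- Theorem 1.8 and Remark 4.4: for `1 ≤ p < q < ∞` there is a strong
embedding `f : ℓ_p → ℓ_q` which is weakly sequentially continuous and weak-to-weak
continuous on every bounded set, but not weak-to-weak continuous globally. -/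
theorem stmt15 (p q : ℝ) (hp : 1 ≤ p) (hpq : p < q)
    [Fact (1 ≤ ENNReal.ofReal p)] [Fact (1 ≤ ENNReal.ofReal q)] :
    ∃ (f : lp (fun _ : ℕ => ℝ) (ENNReal.ofReal p) → lp (fun _ : ℕ => ℝ) (ENNReal.ofReal q))
      (A B : ℝ), 0 < A ∧ 0 < B ∧
      (∀ x y : lp (fun _ : ℕ => ℝ) (ENNReal.ofReal p),
        A * ‖x - y‖ ^ (p / q) ≤ ‖f x - f y‖ ∧ ‖f x - f y‖ ≤ B * ‖x - y‖ ^ (p / q)) ∧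
      WeakSeqCont f ∧
      (∀ s : Set (lp (fun _ : ℕ => ℝ) (ENNReal.ofReal p)), Bornology.IsBounded s →
        @ContinuousOn _ _ (weakTop _) (weakTop _) f s) ∧
      ¬ @Continuous _ _ (weakTop _) (weakTop _) f := by
  have hp0 : 0 < p := by linarith
  have hq0 : 0 < q := hp0.trans hpq
  have hs : 0 < p / q := div_pos hp0 hq0
  have hqr : (ENNReal.ofReal q).toReal = q := ENNReal.toReal_ofReal hq0.le
  obtain ⟨h, A, B, hA, hB, hcont, hzero, habs, hbd⟩ := exists_snowflake_coordinates hp0 hpq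
  obtain ⟨e⟩ := nonempty_equiv_of_countable (α := ℕ) (β := ℕ × (Fin 3 × ℤ))
  have hmain := summable_and_tsum_bounds_of_coordinates hp0 hbd e
  have hmem (x : lp (fun _ : ℕ => ℝ) (ENNReal.ofReal p)) :
      Memℓp (fun m => h (e m).2 (x (e m).1)) (ENNReal.ofReal q) := by
    refine memℓp_gen ?_
    simpa [hqr, hzero] using (hmain x 0).1
  let f : lp (fun _ : ℕ => ℝ) (ENNReal.ofReal p) → lp (fun _ : ℕ => ℝ) (ENNReal.ofReal q) :=
    fun x => ⟨fun m => h (e m).2 (x (e m).1), hmem x⟩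
  have hf (x) (m : ℕ) : f x m = h (e m).2 (x (e m).1) := rfl
  have hnorm (x y) : ‖f x - f y‖ =
      (∑' m, |h (e m).2 (x (e m).1) - h (e m).2 (y (e m).1)| ^ q) ^ (1 / q) := by
    rw [lp.norm_eq_tsum_rpow (by rwa [hqr]), hqr]
    rfl
  have hpow (K : ℝ) (hK : 0 < K) (x y : lp (fun _ : ℕ => ℝ) (ENNReal.ofReal p)) :
      K ^ (1 / q) * ‖x - y‖ ^ (p / q) = (K * ‖x - y‖ ^ p) ^ (1 / q) := by
    rw [Real.mul_rpow hK.le (by positivity), ← Real.rpow_mul (norm_nonneg _), mul_one_div]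
  have hupper (x y) : ‖f x - f y‖ ≤ B ^ (1 / q) * ‖x - y‖ ^ (p / q) := by
    rw [hpow B hB, hnorm]
    have : 0 ≤ ∑' m, |h (e m).2 (x (e m).1) - h (e m).2 (y (e m).1)| ^ q :=
      tsum_nonneg fun m => by positivity
    gcongr
    exact (hmain x y).2.2
  have hweak {α : Type} {l : Filter α} {x : α → lp (fun _ : ℕ => ℝ) (ENNReal.ofReal p)}
      {x₀ : lp (fun _ : ℕ => ℝ) (ENNReal.ofReal p)} {R : ℝ} (hR : ∀ᶠ a in l, ‖x a‖ ≤ R)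
      (hx : ∀ φ : lp (fun _ : ℕ => ℝ) (ENNReal.ofReal p) →L[ℝ] ℝ,
        Tendsto (fun a => φ (x a)) l (nhds (φ x₀)))
      (ψ : lp (fun _ : ℕ => ℝ) (ENNReal.ofReal q) →L[ℝ] ℝ) :
      Tendsto (fun a => ψ (f (x a))) l (nhds (ψ (f x₀))) := by
    refine tendsto_apply_of_bounded_of_tendsto_coord (hp.trans_lt hpq)
      (R := B ^ (1 / q) * (R + ‖x₀‖) ^ (p / q)) ?_ (fun m => ?_) ψ
    · filter_upwards [hR] with a ha
      refine (hupper _ _).trans ?_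
      gcongr
      exact (norm_sub_le _ _).trans (by gcongr)
    · exact ((hcont (e m).2).tendsto _).comp
        (hx (lp.evalCLM ℝ (fun _ : ℕ => ℝ) (ENNReal.ofReal p) (e m).1))
  refine ⟨f, A ^ (1 / q), B ^ (1 / q), by positivity, by positivity,
    fun x y => ⟨?_, hupper x y⟩, fun x x₀ hx => ?_, fun s hsb => ?_, fun hfc => ?_⟩
  · rw [hpow A hA, hnorm]
    gcongr
    exact (hmain x y).2.1
  · obtain ⟨R, hR⟩ := exists_norm_le_of_forall_tendsto_apply hx
    exact hweak (Eventually.of_forall hR) hx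
  · obtain ⟨R, hR⟩ := hsb.exists_norm_le
    refine continuousOn_weakTop_iff.2 fun ψ x₀ _ => hweak (R := R) ?_ (fun φ => ?_) ψ
    · exact mem_inf_of_right (mem_principal.2 hR)
    · exact ((@Continuous.tendsto _ _ (weakTop _) _ _ (continuous_apply_weakTop φ) x₀)).mono_left
        inf_le_left
  · obtain ⟨ψ, hψ⟩ := exists_functional_ge (Q := ENNReal.ofReal q) fun n => e.symm (n, (2, 0))
    have hf0 : f 0 = 0 := by
      ext m
      exact hzero _
    obtain ⟨x, hx0, hx⟩ := exists_line_apply_lt_of_continuous_weakTop hfc ψ (c := 1)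
      (by simp [hf0])
    obtain ⟨n, hn⟩ : ∃ n, x n ≠ 0 := by
      by_contra! hx'
      exact hx0 (lp.ext (funext hx'))
    have hcoord (z : lp (fun _ : ℕ => ℝ) (ENNReal.ofReal p)) (k : ℕ) :
        f z (e.symm (k, (2, 0))) = |z k| ^ (p / q) := by
      simp [hf, habs]
    set r : ℝ := ((2 : ℝ) ^ n) ^ (q / p) with hr
    have hr0 : 0 < r := by positivity
    have h1 := hψ (f ((r / x n) • x)) (fun k => by rw [hcoord]; positivity) n
    have h2 : ((r / x n) • x) n = r := by
      change r / x n * x n = r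
      field_simp
    rw [hcoord, h2, abs_of_pos hr0, hr, ← Real.rpow_mul (by positivity),
      div_mul_div_cancel₀ hp0.ne', div_self hq0.ne', Real.rpow_one, ← mul_pow] at h1
    norm_num at h1
    exact absurd (hx (r / x n)) (not_lt.2 h1)
end

section
/- Let X be a real Banach space, let (x_n) be a weakly null sequence in X, let x ∈ X with x ≠ 0, and let U be a nonprincipal (free) ultrafilter on ℕ. If δ̄_X(‖x_n‖/‖x‖) converges to a along U and ‖x + x_n‖ converges to b along U, then ‖x‖ · a ≤ b − ‖x‖. -/
open Filter

/-- In a finite-dimensional normed space, weakly null functions along a filter are norm null. -/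
theorem tendsto_zero_of_weak_of_finiteDimensional {ι F : Type*} [NormedAddCommGroup F]
    [NormedSpace ℝ F] [FiniteDimensional ℝ F] {l : Filter ι} {v : ι → F}
    (hv : ∀ φ : F →L[ℝ] ℝ, Tendsto (fun i => φ (v i)) l (nhds 0)) :
    Tendsto v l (nhds 0) := by
  let e := Module.finBasis ℝ F
  have h : Tendsto (fun i => ∑ j, e.coord j (v i) • e j) l
      (nhds (∑ j, (0 : ℝ) • e j)) :=
    tendsto_finsetSum _ fun j _ =>
      (hv (LinearMap.toContinuousLinearMap (e.coord j))).smul_const (e j)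
  simpa [e.sum_repr] using h

/-- A weakly null function along a filter is asymptotically contained in any closed subspace of
finite codimension. -/
theorem exists_mem_tendsto_sub_of_weak {X : Type*} [NormedAddCommGroup X] [NormedSpace ℝ X]
    {l : Filter ℕ} (hl : l ≤ atTop) {x : ℕ → X}
    (hx : ∀ φ : X →L[ℝ] ℝ, Tendsto (fun n => φ (x n)) l (nhds 0))
    (E : Subspace ℝ X) (hE : IsClosed (E : Set X)) [FiniteDimensional ℝ (X ⧸ E)] :
    ∃ z : ℕ → X, (∀ n, z n ∈ E) ∧ Tendsto (fun n => ‖z n - x n‖) l (nhds 0) := by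
  have : IsClosed (E : Set X) := hE
  have hq : Tendsto (fun n => E.mkQL (x n)) l (nhds 0) :=
    tendsto_zero_of_weak_of_finiteDimensional fun φ => hx (φ.comp E.mkQL)
  have hpos : ∀ n : ℕ, (0 : ℝ) < 1 / ((n : ℝ) + 1) := fun n => Nat.one_div_pos_of_nat
  choose m hm hmn using fun n => Submodule.Quotient.norm_mk_lt (S := E) (E.mkQL (x n)) (hpos n)
  refine ⟨fun n => x n - m n, fun n => (Submodule.Quotient.eq E).1 (hm n).symm, ?_⟩
  have hlim : Tendsto (fun n : ℕ => ‖E.mkQL (x n)‖ + 1 / ((n : ℝ) + 1)) l (nhds 0) := by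
    simpa using hq.norm.add (tendsto_one_div_add_atTop_nhds_zero_nat.mono_left hl)
  refine squeeze_zero (fun _ => norm_nonneg _) (fun n => ?_) hlim
  simpa using (hmn n).le

/-- The infimum of `‖x + t • y‖ - 1` over the unit sphere of a subspace is at least `-1`. -/
theorem neg_one_le_sInf_norm_add_smul_sub_one {X : Type*} [NormedAddCommGroup X]
    [NormedSpace ℝ X] (x : X) (t : ℝ) (E : Subspace ℝ X) :
    -1 ≤ sInf { u : ℝ | ∃ y : X, y ∈ E ∧ ‖y‖ = 1 ∧ u = ‖x + t • y‖ - 1 } := by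
  refine Real.le_sInf ?_ (by norm_num)
  rintro u ⟨y, -, -, rfl⟩
  linarith [norm_nonneg (x + t • y)]

/-- If a uniform bound holds at one unit vector for all closed subspaces of finite codimension,
then it bounds the modulus of asymptotic uniform convexity. -/
theorem AUCmod_le_s17 {X : Type*} [NormedAddCommGroup X] [NormedSpace ℝ X] {t c : ℝ} {x : X}
    (hx : ‖x‖ = 1)
    (h : ∀ E : Subspace ℝ X, IsClosed (E : Set X) → FiniteDimensional ℝ (X ⧸ E) →
      sInf { u : ℝ | ∃ y : X, y ∈ E ∧ ‖y‖ = 1 ∧ u = ‖x + t • y‖ - 1 } ≤ c) :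
    AUCmod X t ≤ c := by
  have htop : FiniteDimensional ℝ (X ⧸ (⊤ : Subspace ℝ X)) := inferInstance
  refine csInf_le_of_le ⟨-1, ?_⟩ ⟨x, hx, rfl⟩ (csSup_le ⟨_, ⊤, isClosed_univ, htop, rfl⟩ ?_)
  · rintro r ⟨w, -, rfl⟩
    by_cases hb : BddAbove { s : ℝ | ∃ E : Subspace ℝ X, IsClosed (E : Set X) ∧
      FiniteDimensional ℝ (X ⧸ E) ∧
      s = sInf { u : ℝ | ∃ y : X, y ∈ E ∧ ‖y‖ = 1 ∧ u = ‖w + t • y‖ - 1 } }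
    · exact (neg_one_le_sInf_norm_add_smul_sub_one w t ⊤).trans
        (le_csSup hb ⟨⊤, isClosed_univ, htop, rfl⟩)
    · rw [Real.sSup_of_not_bddAbove hb]
      norm_num
  · rintro s ⟨E, hE, hfin, rfl⟩
    exact h E hE hfin

/-- Upper bound, on a fixed closed subspace of finite codimension, for the infimum defining the
modulus of asymptotic uniform convexity, in terms of a weakly null function. -/
theorem sInf_norm_add_smul_sub_one_le {X : Type*} [NormedAddCommGroup X] [NormedSpace ℝ X]
    {l : Filter ℕ} [l.NeBot] (hl : l ≤ atTop) {w : ℕ → X}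
    (hw : ∀ φ : X →L[ℝ] ℝ, Tendsto (fun n => φ (w n)) l (nhds 0))
    {v : X} (hv : ‖v‖ = 1) {τ β : ℝ} (hτ : Tendsto (fun n => ‖w n‖) l (nhds τ))
    (hβ : Tendsto (fun n => ‖v + w n‖) l (nhds β)) (s : ℝ)
    (E : Subspace ℝ X) (hE : IsClosed (E : Set X)) [FiniteDimensional ℝ (X ⧸ E)] :
    sInf { u : ℝ | ∃ y : X, y ∈ E ∧ ‖y‖ = 1 ∧ u = ‖v + s • y‖ - 1 } ≤ β - 1 + |s - τ| := by
  obtain ⟨z, hzE, hz⟩ := exists_mem_tendsto_sub_of_weak hl hw E hE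
  by_cases hunit : ∃ y₀ ∈ E, ‖y₀‖ = 1
  · obtain ⟨y₀, hy₀E, hy₀⟩ := hunit
    have hy : ∀ n, ∃ y ∈ E, ‖y‖ = 1 ∧ z n = ‖z n‖ • y := by
      intro n
      by_cases h0 : z n = 0
      · exact ⟨y₀, hy₀E, hy₀, by simp [h0]⟩
      · refine ⟨‖z n‖⁻¹ • z n, E.smul_mem _ (hzE n), norm_smul_inv_norm h0, ?_⟩
        rw [smul_smul, mul_inv_cancel₀ (norm_ne_zero_iff.2 h0), one_smul]
    have hlim : Tendsto (fun n => ‖v + w n‖ - 1 + (|s - ‖w n‖| + 2 * ‖z n - w n‖)) l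
        (nhds (β - 1 + (|s - τ| + 2 * 0))) :=
      (hβ.sub_const 1).add ((hτ.const_sub s).abs.add (hz.const_mul 2))
    rw [mul_zero, add_zero] at hlim
    refine ge_of_tendsto' hlim fun n => ?_
    obtain ⟨y, hyE, hy1, hzy⟩ := hy n
    have hbdd : BddBelow { u : ℝ | ∃ y : X, y ∈ E ∧ ‖y‖ = 1 ∧ u = ‖v + s • y‖ - 1 } := by
      refine ⟨-1, ?_⟩
      rintro u ⟨y, -, -, rfl⟩
      linarith [norm_nonneg (v + s • y)]
    refine (csInf_le hbdd ⟨y, hyE, hy1, rfl⟩).trans ?_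
    have hdecomp : v + s • y = (v + w n) + (z n - w n) + (s - ‖z n‖) • y := by
      rw [sub_smul, ← hzy]
      abel
    have hnorm : ‖v + s • y‖ ≤ ‖v + w n‖ + ‖z n - w n‖ + |s - ‖z n‖| := by
      rw [hdecomp]
      refine norm_add₃_le.trans_eq ?_
      rw [norm_smul, hy1, mul_one, Real.norm_eq_abs]
    have habs : |s - ‖z n‖| ≤ |s - ‖w n‖| + ‖z n - w n‖ :=
      (abs_sub_le s ‖w n‖ ‖z n‖).trans (by
        rw [norm_sub_rev]
        gcongr
        exact abs_norm_sub_norm_le _ _)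
    linarith
  · have hz0 : ∀ n, z n = 0 := fun n => by
      by_contra h0
      exact hunit ⟨‖z n‖⁻¹ • z n, E.smul_mem _ (hzE n), norm_smul_inv_norm h0⟩
    have hempty : { u : ℝ | ∃ y : X, y ∈ E ∧ ‖y‖ = 1 ∧ u = ‖v + s • y‖ - 1 } = ∅ := by
      rw [Set.eq_empty_iff_forall_notMem]
      rintro u ⟨y, hyE, hy1, -⟩
      exact hunit ⟨y, hyE, hy1⟩
    have hw0 : Tendsto w l (nhds 0) := by
      rw [tendsto_zero_iff_norm_tendsto_zero]
      simpa [hz0] using hz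
    have hβ1 : β = 1 := tendsto_nhds_unique hβ (by simpa [hv] using (hw0.const_add v).norm)
    rw [hempty, Real.sInf_empty, hβ1]
    simp

/-- the basic ultrafilter inequality for the modulus of asymptotic
uniform convexity along a weakly null sequence:
`‖x‖·lim_U δ̄_X(‖x_n‖/‖x‖) ≤ lim_U ‖x + x_n‖ − ‖x‖`. -/
theorem stmt17 {X : Type*} [NormedAddCommGroup X] [NormedSpace ℝ X] [CompleteSpace X]
    (x : ℕ → X) (hwnull : ∀ φ : X →L[ℝ] ℝ, Tendsto (fun n => φ (x n)) atTop (nhds 0))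
    (x₀ : X) (hx₀ : x₀ ≠ 0)
    (U : Ultrafilter ℕ) (hU : (U : Filter ℕ) ≤ Filter.cofinite)
    (a b : ℝ)
    (ha : Tendsto (fun n => AUCmod X (‖x n‖ / ‖x₀‖)) (U : Filter ℕ) (nhds a))
    (hb : Tendsto (fun n => ‖x₀ + x n‖) (U : Filter ℕ) (nhds b)) :
    ‖x₀‖ * a ≤ b - ‖x₀‖ := by
  have hpos : 0 < ‖x₀‖ := norm_pos_iff.2 hx₀
  have hl : (U : Filter ℕ) ≤ atTop := Nat.cofinite_eq_atTop ▸ hU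
  obtain ⟨t, ht⟩ : ∃ t, Tendsto (fun n => ‖x n‖) (U : Filter ℕ) (nhds t) := by
    have hmem : ∀ᶠ n in (U : Filter ℕ), ‖x n‖ ∈ Set.Icc 0 (b + 1 + ‖x₀‖) := by
      filter_upwards [hb.eventually (gt_mem_nhds (lt_add_one b))] with n hn
      have h := norm_sub_le (x₀ + x n) x₀
      rw [add_sub_cancel_left] at h
      exact ⟨norm_nonneg _, by linarith⟩
    obtain ⟨t, -, ht⟩ := isCompact_Icc.ultrafilter_le_nhds (U.map fun n => ‖x n‖)
      (le_principal_iff.2 hmem)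
    exact ⟨t, ht⟩
  have hv : ‖‖x₀‖⁻¹ • x₀‖ = 1 := norm_smul_inv_norm hx₀
  have hw : ∀ φ : X →L[ℝ] ℝ,
      Tendsto (fun n => φ (‖x₀‖⁻¹ • x n)) (U : Filter ℕ) (nhds 0) := fun φ => by
    simpa using ((hwnull φ).mono_left hl).const_mul ‖x₀‖⁻¹
  have hnorm : ∀ y : X, ‖‖x₀‖⁻¹ • y‖ = ‖y‖ / ‖x₀‖ := fun y => by
    rw [norm_smul, norm_inv, norm_norm, inv_mul_eq_div]
  have hτ : Tendsto (fun n => ‖‖x₀‖⁻¹ • x n‖) (U : Filter ℕ) (nhds (t / ‖x₀‖)) := by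
    simpa only [hnorm] using ht.div_const ‖x₀‖
  have hβ : Tendsto (fun n => ‖‖x₀‖⁻¹ • x₀ + ‖x₀‖⁻¹ • x n‖) (U : Filter ℕ)
      (nhds (b / ‖x₀‖)) := by
    simpa only [← smul_add, hnorm] using hb.div_const ‖x₀‖
  have hlim : Tendsto (fun n => b / ‖x₀‖ - 1 + |‖x n‖ / ‖x₀‖ - t / ‖x₀‖|) (U : Filter ℕ)
      (nhds (b / ‖x₀‖ - 1)) := by
    simpa using (((ht.div_const ‖x₀‖).sub_const (t / ‖x₀‖)).abs).const_add (b / ‖x₀‖ - 1)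
  have hab : a ≤ b / ‖x₀‖ - 1 := le_of_tendsto_of_tendsto' ha hlim fun n =>
    AUCmod_le_s17 hv fun E hE _ => sInf_norm_add_smul_sub_one_le hl hw hv hτ hβ _ E hE
  calc ‖x₀‖ * a ≤ ‖x₀‖ * (b / ‖x₀‖ - 1) := by gcongr
    _ = b - ‖x₀‖ := by field_simp
end
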